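/- For every m ≥ 1, every partition μ of m, and every standard μ-tableau U, there exists a unique nonzero idempotent e_U in the Hecke algebra H_m such that y_k e_U = e_U y_k = q^{2c_k(U)} e_U for all k = 1, …, m. -/

import Mathlib

open scoped Classical

noncomputable section

namespace QImm

/-- `q` is not a root of unity. -/
def NotRootOfUnity (q : ℂ) : Prop := ∀ k : ℕ, 0 < k → q ^ k ≠ 1

/-! ### The R-matrices -/

/-- The R-matrix `R = q ∑ eᵢᵢ⊗eᵢᵢ + ∑_{i≠j} eᵢᵢ⊗eⱼⱼ + (q-q⁻¹) ∑_{i<j} eᵢⱼ⊗eⱼᵢ`. -/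
def Rmat (q : ℂ) (n : ℕ) : Matrix (Fin n × Fin n) (Fin n × Fin n) ℂ := fun p r =>
  if p.1 = r.1 ∧ p.2 = r.2 then (if p.1 = p.2 then q else 1)
  else if p.2 = r.1 ∧ p.1 = r.2 ∧ p.1 < r.1 then q - q⁻¹ else 0

/-- The permutation operator `P = ∑ eᵢⱼ⊗eⱼᵢ`. -/
def Pmat (n : ℕ) : Matrix (Fin n × Fin n) (Fin n × Fin n) ℂ := fun p r =>
  if p.1 = r.2 ∧ p.2 = r.1 then 1 else 0

/-- `Ř = P R`. -/
def Rcheck (q : ℂ) (n : ℕ) : Matrix (Fin n × Fin n) (Fin n × Fin n) ℂ :=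
  Pmat n * Rmat q n

/-! ### Embeddings into tensor legs: `(End ℂⁿ)^{⊗m} ⊗ A ≅ Matrix (Fin m → Fin n) (Fin m → Fin n) A` -/

/-- An `n×n` matrix over `A` placed in the `a`-th tensor leg (0-indexed) of
`(End ℂⁿ)^{⊗m} ⊗ A`. -/
def leg1 {A : Type} [Ring A] (n m : ℕ) (X : Matrix (Fin n) (Fin n) A) (a : ℕ) :
    Matrix (Fin m → Fin n) (Fin m → Fin n) A := fun i j =>
  if h : a < m then
    if ∀ c : Fin m, (c : ℕ) ≠ a → i c = j c then X (i ⟨a, h⟩) (j ⟨a, h⟩) else 0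
  else 0

/-- A scalar element of `End ℂⁿ ⊗ End ℂⁿ` placed in the `a`-th and `b`-th tensor legs
(0-indexed) of `(End ℂⁿ)^{⊗m} ⊗ A`. -/
def leg2 (A : Type) [Ring A] [Algebra ℂ A] (n m : ℕ)
    (C : Matrix (Fin n × Fin n) (Fin n × Fin n) ℂ) (a b : ℕ) :
    Matrix (Fin m → Fin n) (Fin m → Fin n) A := fun i j =>
  if h : a < m ∧ b < m then
    if ∀ c : Fin m, (c : ℕ) ≠ a → (c : ℕ) ≠ b → i c = j c then
      algebraMap ℂ A (C (i ⟨a, h.1⟩, i ⟨b, h.2⟩) (j ⟨a, h.1⟩, j ⟨b, h.2⟩))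
    else 0
  else 0

/-- `Ř_{k+1}` (paper numbering), acting in the tensor legs `k`, `k+1` (0-indexed). -/
def RcLeg (A : Type) [Ring A] [Algebra ℂ A] (q : ℂ) (n m : ℕ) (k : ℕ) :
    Matrix (Fin m → Fin n) (Fin m → Fin n) A :=
  leg2 A n m (Rcheck q n) k (k + 1)

/-- `Ř⁻¹_{k+1}` (paper numbering), acting in the tensor legs `k`, `k+1` (0-indexed). -/
def RcLegInv (A : Type) [Ring A] [Algebra ℂ A] (q : ℂ) (n m : ℕ) (k : ℕ) :
    Matrix (Fin m → Fin n) (Fin m → Fin n) A :=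
  leg2 A n m (Rcheck q n)⁻¹ k (k + 1)

/-- `legBar q n m X k` is `X_{\overline{k+1}}` (paper numbering), so `legBar q n m X 0 = X₁`
and `X_{\overline{k+1}} = Ř_k X_{\overline{k}} Ř_k⁻¹`. -/
def legBar {A : Type} [Ring A] [Algebra ℂ A] (q : ℂ) (n m : ℕ)
    (X : Matrix (Fin n) (Fin n) A) : ℕ → Matrix (Fin m → Fin n) (Fin m → Fin n) A
  | 0 => leg1 n m X 0
  | k + 1 => RcLeg A q n m k * legBar q n m X k * RcLegInv A q n m k

/-! ### q-traces -/

/-- The q-trace over all `m` tensor legs: `tr_{q(1,…,m)} Y = tr D₁⋯D_m Y` with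
`D = diag(1, q⁻², …, q^{-2n+2})`. -/
def qTr {A : Type} [Ring A] [Algebra ℂ A] (q : ℂ) (n m : ℕ)
    (Y : Matrix (Fin m → Fin n) (Fin m → Fin n) A) : A :=
  ∑ i : Fin m → Fin n,
    algebraMap ℂ A (∏ a : Fin m, q ^ (-2 * ((i a : ℕ) : ℤ))) * Y i i

/-- The q-trace of a single `n×n` matrix: `tr_q X = tr D X`. -/
def qTr1 {A : Type} [Ring A] [Algebra ℂ A] (q : ℂ) (n : ℕ)
    (X : Matrix (Fin n) (Fin n) A) : A :=
  ∑ j : Fin n, algebraMap ℂ A (q ^ (-2 * ((j : ℕ) : ℤ))) * X j j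

/-! ### The Hecke algebra -/

/-- The defining relations of the Hecke algebra `H_m` on generators `T_1, …, T_{m-1}`
(the generator `i : Fin (m-1)` is `T_{i+1}` in 1-indexed paper notation). -/
inductive HeckeRel (q : ℂ) (m : ℕ) :
    FreeAlgebra ℂ (Fin (m - 1)) → FreeAlgebra ℂ (Fin (m - 1)) → Prop
  | quad (i : Fin (m - 1)) :
      HeckeRel q m
        ((FreeAlgebra.ι ℂ i - algebraMap ℂ (FreeAlgebra ℂ (Fin (m - 1))) q) *
          (FreeAlgebra.ι ℂ i + algebraMap ℂ (FreeAlgebra ℂ (Fin (m - 1))) q⁻¹)) 0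
  | braid (i j : Fin (m - 1)) (h : (j : ℕ) = (i : ℕ) + 1) :
      HeckeRel q m (FreeAlgebra.ι ℂ i * FreeAlgebra.ι ℂ j * FreeAlgebra.ι ℂ i)
        (FreeAlgebra.ι ℂ j * FreeAlgebra.ι ℂ i * FreeAlgebra.ι ℂ j)
  | commute (i j : Fin (m - 1)) (h : (i : ℕ) + 1 < (j : ℕ)) :
      HeckeRel q m (FreeAlgebra.ι ℂ i * FreeAlgebra.ι ℂ j)
        (FreeAlgebra.ι ℂ j * FreeAlgebra.ι ℂ i)

/-- The Hecke algebra `H_m`. -/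
abbrev Hecke (q : ℂ) (m : ℕ) := RingQuot (HeckeRel q m)

/-- The generator `T_{i+1}` (paper 1-indexed) of `H_m`. -/
def Tgen (q : ℂ) (m : ℕ) (i : Fin (m - 1)) : Hecke q m :=
  RingQuot.mkAlgHom ℂ (HeckeRel q m) (FreeAlgebra.ι ℂ i)

/-- `T_{k+1}` (paper 1-indexed), i.e. the 0-indexed `k`-th generator; junk value `1`
out of range. -/
def Tn (q : ℂ) (m : ℕ) (k : ℕ) : Hecke q m :=
  if h : k < m - 1 then Tgen q m ⟨k, h⟩ else 1

/-- The paper's 1-indexed generator `T_a`, `a = 1, …, m-1`. -/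
def Tp (q : ℂ) (m : ℕ) (a : ℕ) : Hecke q m := Tn q m (a - 1)

/-- The Jucys–Murphy elements, 1-indexed: `y_1 = 1`, `y_{k+1} = T_k ⋯ T_2 T_1² T_2 ⋯ T_k`
(the value at `0` is a junk value `1`). -/
def yJM (q : ℂ) (m : ℕ) : ℕ → Hecke q m
  | 0 => 1
  | 1 => 1
  | k + 2 => Tp q m (k + 1) * yJM q m (k + 1) * Tp q m (k + 1)

/-- The element `T_{(i,j)} = T_i T_{i+1} ⋯ T_{j-2} T_{j-1} T_{j-2} ⋯ T_{i+1} T_i` of `H_m`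
associated with the transposition `(i,j)`, `1 ≤ i < j` (paper 1-indexed). -/
def Ttrans (q : ℂ) (m : ℕ) (i j : ℕ) : Hecke q m :=
  ((List.range' i (j - i)).map (Tp q m)).prod *
    (((List.range' i (j - 1 - i)).map (Tp q m)).reverse).prod

/-- The condition that `φ : H_m → End((ℂⁿ)^{⊗m})` is the algebra homomorphism sending
`T_k ↦ Ř_k`. -/
def IsHeckeRep (q : ℂ) (n m : ℕ)
    (φ : Hecke q m →ₐ[ℂ] Matrix (Fin m → Fin n) (Fin m → Fin n) ℂ) : Prop :=
  ∀ k : ℕ, k < m - 1 → φ (Tn q m k) = RcLeg ℂ q n m k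

/-! ### Young diagrams and standard tableaux -/

/-- The content `c(α) = j - i` of a box `α = (i, j)` (row `i`, column `j`, 0-indexed). -/
def ctn (α : ℕ × ℕ) : ℤ := (α.2 : ℤ) - (α.1 : ℤ)

/-- A standard tableau of shape `μ` with `m` boxes, recorded via the position `pos k` of
each entry `k ∈ {1, …, m}`; entries strictly increase along rows and down columns. -/
structure StdTab (μ : YoungDiagram) (m : ℕ) where
  pos : ℕ → ℕ × ℕ
  bij : Set.BijOn pos (Set.Icc 1 m) (μ.cells : Set (ℕ × ℕ))
  row_lt : ∀ k ∈ Set.Icc 1 m, ∀ l ∈ Set.Icc 1 m,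
    (pos k).1 = (pos l).1 → (pos k).2 < (pos l).2 → k < l
  col_lt : ∀ k ∈ Set.Icc 1 m, ∀ l ∈ Set.Icc 1 m,
    (pos k).2 = (pos l).2 → (pos k).1 < (pos l).1 → k < l

/-- `c_k(U)`, the content of the box of `U` occupied by `k`. -/
def ctnAt {μ : YoungDiagram} {m : ℕ} (U : StdTab μ m) (k : ℕ) : ℤ := ctn (U.pos k)

/-- The condition singling out the primitive idempotent `e_U` of `H_m` associated with a
standard tableau `U`: a nonzero idempotent with `y_k e_U = e_U y_k = q^{2c_k(U)} e_U`. -/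
def IsJMIdem (q : ℂ) (m : ℕ) {μ : YoungDiagram} (U : StdTab μ m) (e : Hecke q m) : Prop :=
  e ≠ 0 ∧ e * e = e ∧ ∀ k : ℕ, 1 ≤ k → k ≤ m →
    yJM q m k * e = (q ^ (2 * ctnAt U k) : ℂ) • e ∧
    e * yJM q m k = (q ^ (2 * ctnAt U k) : ℂ) • e

/-! ### The quantized enveloping algebra `U_q(gl_n)` -/

/-- Generators: `inl (i,j) ↦ l⁺_{ij}`, `inr (i,j) ↦ l⁻_{ij}`. -/
abbrev UqGen (n : ℕ) := (Fin n × Fin n) ⊕ (Fin n × Fin n)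

def lpF (n : ℕ) (i j : Fin n) : FreeAlgebra ℂ (UqGen n) := FreeAlgebra.ι ℂ (Sum.inl (i, j))
def lmF (n : ℕ) (i j : Fin n) : FreeAlgebra ℂ (UqGen n) := FreeAlgebra.ι ℂ (Sum.inr (i, j))

/-- A matrix `X` over `F` placed in the first of two matrix legs of
`End ℂⁿ ⊗ End ℂⁿ ⊗ F`. -/
def M1 {F : Type} [Ring F] {n : ℕ} (X : Fin n → Fin n → F) :
    Matrix (Fin n × Fin n) (Fin n × Fin n) F := fun p r => if p.2 = r.2 then X p.1 r.1 else 0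

/-- A matrix `X` over `F` placed in the second of two matrix legs of
`End ℂⁿ ⊗ End ℂⁿ ⊗ F`. -/
def M2 {F : Type} [Ring F] {n : ℕ} (X : Fin n → Fin n → F) :
    Matrix (Fin n × Fin n) (Fin n × Fin n) F := fun p r => if p.1 = r.1 then X p.2 r.2 else 0

/-- The R-matrix, viewed over the free algebra on the generators of `U_q(gl_n)`. -/
def RmatU (q : ℂ) (n : ℕ) : Matrix (Fin n × Fin n) (Fin n × Fin n) (FreeAlgebra ℂ (UqGen n)) :=
  (Rmat q n).map (algebraMap ℂ (FreeAlgebra ℂ (UqGen n)))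

/-- The defining relations of `U_q(gl_n)`. -/
inductive UqRel (q : ℂ) (n : ℕ) :
    FreeAlgebra ℂ (UqGen n) → FreeAlgebra ℂ (UqGen n) → Prop
  | upperZero (i j : Fin n) (h : j < i) : UqRel q n (lpF n i j) 0
  | lowerZero (i j : Fin n) (h : i < j) : UqRel q n (lmF n i j) 0
  | diagPM (i : Fin n) : UqRel q n (lpF n i i * lmF n i i) 1
  | diagMP (i : Fin n) : UqRel q n (lmF n i i * lpF n i i) 1
  | rllPP (x y : Fin n × Fin n) :
      UqRel q n ((RmatU q n * M1 (lpF n) * M2 (lpF n)) x y)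
        ((M2 (lpF n) * M1 (lpF n) * RmatU q n) x y)
  | rllMM (x y : Fin n × Fin n) :
      UqRel q n ((RmatU q n * M1 (lmF n) * M2 (lmF n)) x y)
        ((M2 (lmF n) * M1 (lmF n) * RmatU q n) x y)
  | rllPM (x y : Fin n × Fin n) :
      UqRel q n ((RmatU q n * M1 (lpF n) * M2 (lmF n)) x y)
        ((M2 (lmF n) * M1 (lpF n) * RmatU q n) x y)

/-- The quantized enveloping algebra `U_q(gl_n)`. -/
abbrev Uq (q : ℂ) (n : ℕ) := RingQuot (UqRel q n)

def lp (q : ℂ) (n : ℕ) (i j : Fin n) : Uq q n := RingQuot.mkAlgHom ℂ (UqRel q n) (lpF n i j)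
def lm (q : ℂ) (n : ℕ) (i j : Fin n) : Uq q n := RingQuot.mkAlgHom ℂ (UqRel q n) (lmF n i j)

/-- The matrix `L⁺`. -/
def Lp (q : ℂ) (n : ℕ) : Matrix (Fin n) (Fin n) (Uq q n) := Matrix.of fun i j => lp q n i j
/-- The matrix `L⁻`. -/
def Lm (q : ℂ) (n : ℕ) : Matrix (Fin n) (Fin n) (Uq q n) := Matrix.of fun i j => lm q n i j

/-- `L = L⁺ (L⁻)⁻¹`, where `K` is the (two-sided) inverse of `L⁻`. -/
def Lmat (q : ℂ) (n : ℕ) (K : Matrix (Fin n) (Fin n) (Uq q n)) :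
    Matrix (Fin n) (Fin n) (Uq q n) := Lp q n * K

/-! ### The braided Weyl algebra -/

/-- Generators: `inl (i,j) ↦ m_{ij}`, `inr (i,j) ↦ ∂_{ij}`. -/
abbrev WGen (n : ℕ) := (Fin n × Fin n) ⊕ (Fin n × Fin n)

def mgF (n : ℕ) (i j : Fin n) : FreeAlgebra ℂ (WGen n) := FreeAlgebra.ι ℂ (Sum.inl (i, j))
def dgF (n : ℕ) (i j : Fin n) : FreeAlgebra ℂ (WGen n) := FreeAlgebra.ι ℂ (Sum.inr (i, j))

def RcW (q : ℂ) (n : ℕ) : Matrix (Fin n × Fin n) (Fin n × Fin n) (FreeAlgebra ℂ (WGen n)) :=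
  (Rcheck q n).map (algebraMap ℂ (FreeAlgebra ℂ (WGen n)))

def RcWInv (q : ℂ) (n : ℕ) : Matrix (Fin n × Fin n) (Fin n × Fin n) (FreeAlgebra ℂ (WGen n)) :=
  ((Rcheck q n)⁻¹).map (algebraMap ℂ (FreeAlgebra ℂ (WGen n)))

/-- The defining relations of the braided Weyl algebra `W_n`. -/
inductive WRel (q : ℂ) (n : ℕ) :
    FreeAlgebra ℂ (WGen n) → FreeAlgebra ℂ (WGen n) → Prop
  | mm (x y : Fin n × Fin n) :
      WRel q n ((RcW q n * M1 (mgF n) * RcW q n * M1 (mgF n)) x y)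
        ((M1 (mgF n) * RcW q n * M1 (mgF n) * RcW q n) x y)
  | dd (x y : Fin n × Fin n) :
      WRel q n ((RcWInv q n * M1 (dgF n) * RcWInv q n * M1 (dgF n)) x y)
        ((M1 (dgF n) * RcWInv q n * M1 (dgF n) * RcWInv q n) x y)
  | dm (x y : Fin n × Fin n) :
      WRel q n ((M1 (dgF n) * RcW q n * M1 (mgF n)) x y)
        ((RcW q n * M1 (mgF n) * RcWInv q n * M1 (dgF n) * RcWInv q n + 1) x y)

/-- The braided Weyl algebra `W_n`. -/
abbrev Weyl (q : ℂ) (n : ℕ) := RingQuot (WRel q n)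

def mW (q : ℂ) (n : ℕ) (i j : Fin n) : Weyl q n := RingQuot.mkAlgHom ℂ (WRel q n) (mgF n i j)
def dW (q : ℂ) (n : ℕ) (i j : Fin n) : Weyl q n := RingQuot.mkAlgHom ℂ (WRel q n) (dgF n i j)

/-- The matrix `M = [m_{ij}]` over `W_n`. -/
def Mmat (q : ℂ) (n : ℕ) : Matrix (Fin n) (Fin n) (Weyl q n) := Matrix.of fun i j => mW q n i j
/-- The matrix `𝒟 = [∂_{ij}]` over `W_n`. -/
def Dmat (q : ℂ) (n : ℕ) : Matrix (Fin n) (Fin n) (Weyl q n) := Matrix.of fun i j => dW q n i j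

/-- The image `L = M𝒟 - (q - q⁻¹)⁻¹·1` of `L` in the braided Weyl algebra. -/
def LW (q : ℂ) (n : ℕ) : Matrix (Fin n) (Fin n) (Weyl q n) :=
  Mmat q n * Dmat q n - ((q - q⁻¹)⁻¹ : ℂ) • 1

/-! ### The q-immanant polynomials -/

/-- The matrix `(L_{1̄} + z q^{-2c₁(U)}) ⋯ (L_{m̄} + z q^{-2c_m(U)}) E_U`, where `E` is the
image `E_U` of the primitive idempotent `e_U`. -/
def prodU {A : Type} [Ring A] [Algebra ℂ A] (q : ℂ) (n m : ℕ) {μ : YoungDiagram}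
    (U : StdTab μ m) (E : Matrix (Fin m → Fin n) (Fin m → Fin n) ℂ)
    (X : Matrix (Fin n) (Fin n) A) (z : ℂ) :
    Matrix (Fin m → Fin n) (Fin m → Fin n) A :=
  (((List.range m).map fun k =>
      legBar q n m X k + ((z * q ^ (-2 * ctnAt U (k + 1))) : ℂ) • 1)).prod *
    E.map (algebraMap ℂ A)

/-- The q-immanant polynomial
`S_U(z) = tr_{q(1,…,m)} (L_{1̄} + z q^{-2c₁(U)}) ⋯ (L_{m̄} + z q^{-2c_m(U)}) E_U`. -/
def SUpoly {A : Type} [Ring A] [Algebra ℂ A] (q : ℂ) (n m : ℕ) {μ : YoungDiagram}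
    (U : StdTab μ m) (E : Matrix (Fin m → Fin n) (Fin m → Fin n) ℂ)
    (X : Matrix (Fin n) (Fin n) A) (z : ℂ) : A :=
  qTr q n m (prodU q n m U E X z)

/-- The coefficient `a_μ = ∏_{α ∈ μ} q^{-2c(α)}`. -/
def aCoeff (q : ℂ) (μ : YoungDiagram) : ℂ := ∏ α ∈ μ.cells, q ^ (-2 * ctn α)

/-- `tr_{q(1,…,m)} L_{1̄} ⋯ L_{m̄} E_{(1^m)}`, where `Em` is the image of the primitive
idempotent associated with the column diagram `(1^m)`. -/
def colElem (q : ℂ) (n k : ℕ) (K : Matrix (Fin n) (Fin n) (Uq q n))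
    (φk : Hecke q k →ₐ[ℂ] Matrix (Fin k → Fin n) (Fin k → Fin n) ℂ)
    (ek : Hecke q k) : Uq q n :=
  qTr q n k (((List.range k).map fun j => legBar q n k (Lmat q n K) j).prod *
    (φk ek).map (algebraMap ℂ (Uq q n)))

/-- The semistandardness condition on a filling of the boxes of `μ` with entries in
`{1, …, n}` (encoded as `Fin n`): weakly increasing along rows, strictly increasing
down columns. -/
def SSYTCond {n : ℕ} (μ : YoungDiagram) (f : {x // x ∈ μ.cells} → Fin n) : Prop :=
  (∀ a b : {x // x ∈ μ.cells}, (a : ℕ × ℕ).1 = (b : ℕ × ℕ).1 →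
    (a : ℕ × ℕ).2 ≤ (b : ℕ × ℕ).2 → f a ≤ f b) ∧
  (∀ a b : {x // x ∈ μ.cells}, (a : ℕ × ℕ).2 = (b : ℕ × ℕ).2 →
    (a : ℕ × ℕ).1 < (b : ℕ × ℕ).1 → f a < f b)

/-- The factorial Schur polynomial `s_μ(x₁,…,x_n | a)` evaluated at `x_i = q^{2ℓ_i}`,
`ℓ_i = λ_i - i + 1` (1-indexed), with parameter sequence `a_j = z q^{1-2j}`. -/
def factSchur {n : ℕ} (q z : ℂ) (lam : Fin n → ℤ) (μ : YoungDiagram) : ℂ :=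
  ∑ f : {x // x ∈ μ.cells} → Fin n,
    if SSYTCond μ f then
      ∏ α : {x // x ∈ μ.cells},
        (q ^ (2 * (lam (f α) - ((f α : ℕ) : ℤ))) +
          z * q ^ (1 - 2 * (((f α : ℕ) : ℤ) + 1 + ctn (α : ℕ × ℕ))))
    else 0

/-! ### Contents of growing Young diagrams

A Young diagram is recorded by the multiset of the contents of its boxes. In the Russian
convention its boundary is the graph of `bdry n`; addable and removable boxes are the local minima
and the local maxima of this function. -/

/-- The boundary function of the diagram whose multiset of contents is `n`. -/
def bdry (n : Multiset ℤ) (x : ℤ) : ℤ := |x| + 2 * (n.count x : ℤ)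

/-- A box of content `k` can be added to `n`. -/
def IsAddable (n : Multiset ℤ) (k : ℤ) : Prop :=
  bdry n (k + 1) = bdry n k + 1 ∧ bdry n (k - 1) = bdry n k + 1

/-- A box of content `k` can be removed from `n`. -/
def IsRemovable (n : Multiset ℤ) (k : ℤ) : Prop :=
  bdry n (k + 1) = bdry n k - 1 ∧ bdry n (k - 1) = bdry n k - 1

lemma bdry_cons_self (n : Multiset ℤ) (k : ℤ) : bdry (k ::ₘ n) k = bdry n k + 2 := by
  simp [bdry]; ring

lemma bdry_cons_of_ne {n : Multiset ℤ} {k x : ℤ} (h : x ≠ k) :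
    bdry (k ::ₘ n) x = bdry n x := by
  simp [bdry, Multiset.count_cons_of_ne h]

lemma isRemovable_cons_self {n : Multiset ℤ} {k : ℤ} :
    IsRemovable (k ::ₘ n) k ↔ IsAddable n k := by
  unfold IsRemovable IsAddable
  rw [bdry_cons_self, bdry_cons_of_ne (by omega), bdry_cons_of_ne (by omega)]
  constructor <;> rintro ⟨h1, h2⟩ <;> constructor <;> omega

lemma not_isAddable_cons_self {n : Multiset ℤ} {k : ℤ} (h : IsAddable n k) :
    ¬ IsAddable (k ::ₘ n) k := by
  intro h'
  have := (isRemovable_cons_self.2 h).1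
  have := h'.1
  omega

lemma isAddable_cons_of_far {n : Multiset ℤ} {k l : ℤ} (h0 : l ≠ k) (h1 : l ≠ k + 1)
    (h2 : l ≠ k - 1) : IsAddable (k ::ₘ n) l ↔ IsAddable n l := by
  unfold IsAddable
  rw [bdry_cons_of_ne h0, bdry_cons_of_ne (by omega), bdry_cons_of_ne (by omega)]

lemma isRemovable_cons_of_far {n : Multiset ℤ} {k l : ℤ} (h0 : l ≠ k) (h1 : l ≠ k + 1)
    (h2 : l ≠ k - 1) : IsRemovable (k ::ₘ n) l ↔ IsRemovable n l := by
  unfold IsRemovable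
  rw [bdry_cons_of_ne h0, bdry_cons_of_ne (by omega), bdry_cons_of_ne (by omega)]

/-- Two distinct removable boxes are not on neighbouring diagonals. -/
lemma IsRemovable.far {n : Multiset ℤ} {k l : ℤ} (hk : IsRemovable n k) (hl : IsRemovable n l) :
    l ≠ k + 1 ∧ l ≠ k - 1 := by
  constructor <;> rintro rfl
  · have := hk.1; have := hl.2; simp at this; omega
  · have := hk.2; have := hl.1; simp at this; omega

lemma IsAddable.far {n : Multiset ℤ} {k l : ℤ} (hk : IsAddable n k) (hl : IsAddable n l) :
    l ≠ k + 1 ∧ l ≠ k - 1 := by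
  constructor <;> rintro rfl
  · have := hk.1; have := hl.2; simp at this; omega
  · have := hk.2; have := hl.1; simp at this; omega

lemma IsRemovable.mem {n : Multiset ℤ} {k : ℤ} (h : IsRemovable n k) : k ∈ n := by
  rw [← Multiset.one_le_count_iff_mem]
  by_contra hn
  have h0 : n.count k = 0 := by omega
  obtain ⟨h1, h2⟩ := h
  simp only [bdry, h0] at h1 h2
  rcases abs_cases k with h | h <;> rcases abs_cases (k + 1) with h' | h' <;>
    rcases abs_cases (k - 1) with h'' | h'' <;> omega

/-- The contents of the addable boxes. -/
def addables (n : Multiset ℤ) : Finset ℤ :=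
  ({0} ∪ n.toFinset.image (· + 1) ∪ n.toFinset.image (· - 1)).filter (IsAddable n)

/-- The contents of the removable boxes. -/
def removables (n : Multiset ℤ) : Finset ℤ := n.toFinset.filter (IsRemovable n)

lemma mem_removables {n : Multiset ℤ} {k : ℤ} : k ∈ removables n ↔ IsRemovable n k := by
  simp only [removables, Finset.mem_filter, Multiset.mem_toFinset, and_iff_right_iff_imp]
  exact fun h => h.mem

lemma mem_addables {n : Multiset ℤ} {k : ℤ} : k ∈ addables n ↔ IsAddable n k := by
  simp only [addables, Finset.mem_filter, and_iff_right_iff_imp]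
  intro h
  by_contra hn
  simp only [Finset.mem_union, Finset.mem_singleton, Finset.mem_image, Multiset.mem_toFinset,
    not_or, not_exists, not_and] at hn
  obtain ⟨⟨h0, hp⟩, hm⟩ := hn
  have h1 : n.count (k - 1) = 0 := Multiset.count_eq_zero.2 fun h => hp _ h (by ring)
  have h2 : n.count (k + 1) = 0 := Multiset.count_eq_zero.2 fun h => hm _ h (by ring)
  obtain ⟨h3, h4⟩ := h
  simp only [bdry, h1, h2] at h3 h4
  rcases abs_cases k with h | h <;> rcases abs_cases (k + 1) with h' | h' <;>
    rcases abs_cases (k - 1) with h'' | h'' <;> omega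

/-- `n` is the multiset of contents of a diagram: its boundary has steps `±1`. -/
def IsDiagram (n : Multiset ℤ) : Prop := ∀ x, |bdry n (x + 1) - bdry n x| = 1

lemma isDiagram_zero : IsDiagram 0 := by
  intro x
  simp only [bdry, Multiset.count_zero]
  rcases abs_cases x with h | h <;> rcases abs_cases (x + 1) with h' | h' <;>
    rw [h.1, h'.1] <;> rw [abs_eq] <;> omega

lemma isDiagram_cons {n : Multiset ℤ} {k : ℤ} (hk : IsAddable n k) :
    IsDiagram (k ::ₘ n) ↔ IsDiagram n := by
  refine forall_congr' fun x => ?_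
  obtain ⟨h1, h2⟩ := hk
  by_cases hx : x = k
  · subst hx
    rw [bdry_cons_self, bdry_cons_of_ne (by omega), h1, abs_eq (by simp), abs_eq (by simp)]
    omega
  by_cases hx' : x + 1 = k
  · subst hx'
    simp only [add_sub_cancel_right] at h2
    rw [bdry_cons_self, bdry_cons_of_ne (by omega), h2, abs_eq (by simp), abs_eq (by simp)]
    omega
  · rw [bdry_cons_of_ne hx, bdry_cons_of_ne hx']

/-- A diagram has one more addable box than removable boxes: sum the second difference of the
boundary function. -/
lemma IsDiagram.card_addables {n : Multiset ℤ} (hn : IsDiagram n) :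
    (addables n).card = (removables n).card + 1 := by
  obtain ⟨M, hM⟩ : ∃ M : ℕ, ∀ x ∈ n, |x| < M := by
    refine ⟨(n.map Int.natAbs).sum + 1, fun x hx => ?_⟩
    have := Multiset.le_sum_of_mem (Multiset.mem_map_of_mem Int.natAbs hx)
    rw [Int.abs_eq_natAbs]
    omega
  have hout : ∀ x : ℤ, (M : ℤ) ≤ |x| → bdry n x = |x| := by
    intro x hx
    have : n.count x = 0 := Multiset.count_eq_zero.2 fun h => by have := hM x h; omega
    simp [bdry, this]
  set W : Finset ℤ := (Finset.range (2 * M + 3)).image fun i : ℕ => (i : ℤ) - M - 1 with hW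
  have memW : ∀ x : ℤ, |x| ≤ M + 1 → x ∈ W := by
    intro x hx
    rw [abs_le] at hx
    refine Finset.mem_image.2 ⟨(x + M + 1).toNat, ?_, ?_⟩
    · simp; omega
    · omega
  have hA : addables n = W.filter (IsAddable n) := by
    ext x
    simp only [mem_addables, Finset.mem_filter, iff_and_self]
    intro hx
    apply memW
    by_contra hc
    obtain ⟨h1, h2⟩ := hx
    rcases abs_cases x with h | h <;> rcases abs_cases (x + 1) with h' | h' <;>
      rcases abs_cases (x - 1) with h'' | h'' <;>
      rw [hout x (by omega)] at h1 h2 <;> rw [hout _ (by omega)] at h1 h2 <;> omega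
  have hR : removables n = W.filter (IsRemovable n) := by
    ext x
    simp only [mem_removables, Finset.mem_filter, iff_and_self]
    intro hx
    exact memW x (by have := hM x hx.mem; omega)
  have key : ∀ x, (2 : ℤ) * ((if IsAddable n x then 1 else 0) - (if IsRemovable n x then 1 else 0))
      = (bdry n (x + 1) - bdry n x) - (bdry n x - bdry n (x - 1)) := by
    intro x
    have h1 := hn x
    have h2 := hn (x - 1)
    rw [sub_add_cancel] at h2
    rw [abs_eq (by simp)] at h1 h2
    unfold IsAddable IsRemovable
    split_ifs <;> omega
  have hsum : (2 : ℤ) * ((addables n).card - (removables n).card) =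
      ∑ x ∈ W, ((bdry n (x + 1) - bdry n x) - (bdry n x - bdry n (x - 1))) := by
    rw [hA, hR, Finset.card_filter, Finset.card_filter]
    push_cast
    rw [← Finset.sum_sub_distrib, Finset.mul_sum]
    exact Finset.sum_congr rfl fun x _ => key x
  rw [hW, Finset.sum_image (by intro a _ b _ h; simp at h; omega)] at hsum
  have tel := Finset.sum_range_sub
    (fun i : ℕ => bdry n ((i : ℤ) - M - 1) - bdry n ((i : ℤ) - M - 2)) (2 * M + 3)
  have : ∀ i : ℕ, (bdry n ((i : ℤ) - M - 1 + 1) - bdry n ((i : ℤ) - M - 1)) -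
      (bdry n ((i : ℤ) - M - 1) - bdry n ((i : ℤ) - M - 1 - 1)) =
      (bdry n (((i + 1 : ℕ) : ℤ) - M - 1) - bdry n (((i + 1 : ℕ) : ℤ) - M - 2)) -
      (bdry n ((i : ℤ) - M - 1) - bdry n ((i : ℤ) - M - 2)) := by
    intro i
    congr! 3 <;> push_cast <;> ring
  rw [Finset.sum_congr rfl fun i _ => this i, tel] at hsum
  have e1 : ((2 * M + 3 : ℕ) : ℤ) - M - 1 = M + 2 := by push_cast; ring
  have e2 : ((2 * M + 3 : ℕ) : ℤ) - M - 2 = M + 1 := by push_cast; ring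
  rw [e1, e2, hout (M + 2) (le_abs_self _ |>.trans' (by omega)),
    hout (M + 1) (le_abs_self _ |>.trans' (by omega)),
    hout _ (neg_le_abs _ |>.trans' (by push_cast; omega)),
    hout _ (neg_le_abs _ |>.trans' (by push_cast; omega)),
    abs_of_nonneg (by positivity), abs_of_nonneg (by positivity),
    abs_of_nonpos (by push_cast; omega), abs_of_nonpos (by push_cast; omega)] at hsum
  push_cast at hsum
  omega

/-! ### Content sequences -/

/-- The multiset of the first `k` values of `c`. -/
def shape (c : ℕ → ℤ) (k : ℕ) : Multiset ℤ := (Multiset.range k).map c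

lemma shape_zero (c : ℕ → ℤ) : shape c 0 = 0 := rfl

lemma shape_succ (c : ℕ → ℤ) (k : ℕ) : shape c (k + 1) = c k ::ₘ shape c k := by
  simp [shape, Multiset.range_succ]

lemma shape_congr {c d : ℕ → ℤ} {k : ℕ} (h : ∀ i < k, c i = d i) : shape c k = shape d k :=
  Multiset.map_congr rfl fun i hi => h i (Multiset.mem_range.1 hi)

/-- The first `m` values of `c` are the contents of the successive boxes of a standard tableau. -/
def IsContentSeq (m : ℕ) (c : ℕ → ℤ) : Prop := ∀ k < m, IsAddable (shape c k) (c k)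

lemma IsContentSeq.mono {m m' : ℕ} {c : ℕ → ℤ} (h : IsContentSeq m c) (hm : m' ≤ m) :
    IsContentSeq m' c := fun k hk => h k (hk.trans_le hm)

lemma isContentSeq_congr {m : ℕ} {c d : ℕ → ℤ} (h : ∀ i < m, c i = d i) :
    IsContentSeq m c ↔ IsContentSeq m d := by
  refine forall₂_congr fun k hk => ?_
  rw [h k hk, shape_congr fun i hi => h i (hi.trans hk)]

lemma isContentSeq_succ {m : ℕ} {c : ℕ → ℤ} :
    IsContentSeq (m + 1) c ↔ IsContentSeq m c ∧ IsAddable (shape c m) (c m) := by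
  simp only [IsContentSeq, Nat.lt_succ_iff_lt_or_eq, or_imp, forall_and, forall_eq]

lemma IsContentSeq.isDiagram {m : ℕ} {c : ℕ → ℤ} (h : IsContentSeq m c) :
    IsDiagram (shape c m) := by
  induction m with
  | zero => exact isDiagram_zero
  | succ m ih =>
    obtain ⟨h1, h2⟩ := isContentSeq_succ.1 h
    rw [shape_succ, isDiagram_cons h2]
    exact ih h1

/-- The content sequences of length `m`, extended by zero. -/
def contentSeqs : ℕ → Finset (ℕ → ℤ)
  | 0 => {0}
  | m + 1 => (contentSeqs m).biUnion fun c =>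
      (addables (shape c m)).image fun k => Function.update c m k

lemma mem_contentSeqs {m : ℕ} {c : ℕ → ℤ} :
    c ∈ contentSeqs m ↔ (∀ k, m ≤ k → c k = 0) ∧ IsContentSeq m c := by
  induction m generalizing c with
  | zero => simp [contentSeqs, IsContentSeq, funext_iff]
  | succ m ih =>
    simp only [contentSeqs, Finset.mem_biUnion, Finset.mem_image, mem_addables, ih,
      isContentSeq_succ]
    constructor
    · rintro ⟨d, ⟨hd0, hd⟩, k, hk, rfl⟩
      have hag : ∀ i < m, Function.update d m k i = d i := fun i hi =>
        Function.update_of_ne (by omega) _ _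
      rw [isContentSeq_congr hag, shape_congr hag]
      refine ⟨fun i hi => ?_, hd, by simpa using hk⟩
      rw [Function.update_of_ne (by omega), hd0 i (by omega)]
    · rintro ⟨h0, h1, h2⟩
      have hag : ∀ i < m, Function.update c m 0 i = c i := fun i hi =>
        Function.update_of_ne (by omega) _ _
      refine ⟨Function.update c m 0, ⟨fun k hk => ?_, (isContentSeq_congr hag).2 h1⟩, c m, ?_, ?_⟩
      · rcases hk.eq_or_lt with rfl | hk
        · simp
        · rw [Function.update_of_ne (by omega), h0 k hk]
      · rwa [shape_congr hag]
      · simp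

lemma sum_contentSeqs_succ (m : ℕ) (F : (ℕ → ℤ) → ℕ) :
    ∑ c ∈ contentSeqs (m + 1), F c =
      ∑ c ∈ contentSeqs m, ∑ k ∈ addables (shape c m), F (Function.update c m k) := by
  rw [contentSeqs, Finset.sum_biUnion]
  · refine Finset.sum_congr rfl fun c _ => Finset.sum_image fun a _ b _ h => ?_
    simpa using congrFun h m
  · intro c hc d hd hne
    rw [Function.onFun, Finset.disjoint_left]
    intro x hx hx'
    obtain ⟨k, -, rfl⟩ := Finset.mem_image.1 hx
    obtain ⟨l, -, h⟩ := Finset.mem_image.1 hx'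
    apply hne
    funext i
    rcases eq_or_ne i m with rfl | hi
    · rw [(mem_contentSeqs.1 hc).1 i le_rfl, (mem_contentSeqs.1 hd).1 i le_rfl]
    · simpa [hi] using (congrFun h i).symm

lemma shape_update (c : ℕ → ℤ) (m : ℕ) (k : ℤ) :
    shape (Function.update c m k) (m + 1) = k ::ₘ shape c m := by
  rw [shape_succ, Function.update_self,
    shape_congr fun i hi => Function.update_of_ne (by omega) _ _]

/-- The number of standard tableaux whose diagram has content multiset `n`. -/
def numSeqs (m : ℕ) (n : Multiset ℤ) : ℕ := ∑ c ∈ contentSeqs m, if shape c m = n then 1 else 0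

lemma numSeqs_succ (m : ℕ) (n : Multiset ℤ) :
    numSeqs (m + 1) n = ∑ l ∈ removables n, numSeqs m (n.erase l) := by
  unfold numSeqs
  rw [sum_contentSeqs_succ, Finset.sum_comm]
  refine Finset.sum_congr rfl fun c _ => ?_
  simp only [shape_update]
  rw [← Finset.card_filter, ← Finset.card_filter]
  congr 1
  ext k
  simp only [Finset.mem_filter, mem_addables, mem_removables]
  constructor
  · rintro ⟨h, rfl⟩
    exact ⟨isRemovable_cons_self.2 h, by simp⟩
  · rintro ⟨h, h'⟩
    have : k ::ₘ shape c m = n := by rw [h', Multiset.cons_erase h.mem]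
    exact ⟨isRemovable_cons_self.1 (this ▸ h), this⟩

lemma numSeqs_zero_cons (k : ℤ) (n : Multiset ℤ) : numSeqs 0 (k ::ₘ n) = 0 := by
  simp [numSeqs, shape_zero, contentSeqs]

/-- Adding a box at `k` and removing one at `l ≠ k` can be done in either order. -/
lemma addable_removable_comm {n : Multiset ℤ} {k l : ℤ} (hkl : k ≠ l) :
    (IsAddable n k ∧ IsRemovable (k ::ₘ n) l) ↔
      (IsRemovable n l ∧ IsAddable (n.erase l) k) := by
  constructor
  · rintro ⟨h1, h2⟩
    obtain ⟨h3, h4⟩ := (isRemovable_cons_self.2 h1).far h2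
    have h5 := (isRemovable_cons_of_far hkl.symm h3 h4).1 h2
    refine ⟨h5, ?_⟩
    rw [← Multiset.cons_erase h5.mem] at h1
    exact (isAddable_cons_of_far hkl (by omega) (by omega)).1 h1
  · rintro ⟨h1, h2⟩
    obtain ⟨s, rfl⟩ := Multiset.exists_cons_of_mem h1.mem
    rw [Multiset.erase_cons_head] at h2
    obtain ⟨h3, h4⟩ := (isRemovable_cons_self.1 h1).far h2
    refine ⟨(isAddable_cons_of_far hkl h3 h4).2 h2, ?_⟩
    exact (isRemovable_cons_of_far hkl.symm (by omega) (by omega)).2 h1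

lemma sum_numSeqs_cons (m : ℕ) {n : Multiset ℤ} (hn : IsDiagram n) :
    ∑ k ∈ addables n, numSeqs (m + 1) (k ::ₘ n) = (m + 1) * numSeqs m n := by
  induction m generalizing n with
  | zero => ?_
  | succ m ih => ?_
  all_goals
    have hL : ∀ m, ∑ k ∈ addables n, numSeqs (m + 1) (k ::ₘ n) =
        (addables n).card * numSeqs m n + ∑ k ∈ addables n,
          ∑ l ∈ (removables (k ::ₘ n)).erase k, numSeqs m ((k ::ₘ n).erase l) := by
      intro m
      rw [← smul_eq_mul, ← Finset.sum_const, ← Finset.sum_add_distrib]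
      refine Finset.sum_congr rfl fun k hk => ?_
      rw [numSeqs_succ, ← Finset.add_sum_erase _ _
        (mem_removables.2 (isRemovable_cons_self.2 (mem_addables.1 hk))), Multiset.erase_cons_head]
    have hR : ∀ m, ∑ l ∈ removables n, ∑ k ∈ addables (n.erase l), numSeqs m (k ::ₘ n.erase l) =
        (removables n).card * numSeqs m n + ∑ l ∈ removables n,
          ∑ k ∈ (addables (n.erase l)).erase l, numSeqs m (k ::ₘ n.erase l) := by
      intro m
      rw [← smul_eq_mul, ← Finset.sum_const, ← Finset.sum_add_distrib]
      refine Finset.sum_congr rfl fun l hl => ?_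
      have hl := mem_removables.1 hl
      have hl' : IsAddable (n.erase l) l := by
        rw [← isRemovable_cons_self, Multiset.cons_erase hl.mem]; exact hl
      rw [← Finset.add_sum_erase _ _ (mem_addables.2 hl'), Multiset.cons_erase hl.mem]
    have hLR : ∀ m, ∑ k ∈ addables n,
          ∑ l ∈ (removables (k ::ₘ n)).erase k, numSeqs m ((k ::ₘ n).erase l) =
        ∑ l ∈ removables n,
          ∑ k ∈ (addables (n.erase l)).erase l, numSeqs m (k ::ₘ n.erase l) := by
      intro m
      rw [Finset.sum_comm' (t' := removables n) (s' := fun l => (addables (n.erase l)).erase l)]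
      · refine Finset.sum_congr rfl fun l _ => Finset.sum_congr rfl fun k hk => ?_
        rw [Multiset.erase_cons_tail _ (Finset.ne_of_mem_erase hk)]
      · intro k l
        simp only [Finset.mem_erase, mem_addables, mem_removables]
        by_cases hkl : k = l
        · simp [hkl]
        · have := addable_removable_comm (n := n) hkl
          simp only [ne_eq, hkl, Ne.symm hkl, not_false_eq_true, true_and, this, and_comm]
    have hT : ∀ m, ∑ k ∈ addables n, numSeqs (m + 1) (k ::ₘ n) = numSeqs m n +
        ∑ l ∈ removables n, ∑ k ∈ addables (n.erase l), numSeqs m (k ::ₘ n.erase l) := by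
      intro m
      rw [hL, hR, hLR, hn.card_addables]
      ring
    rw [hT]
  · simp [numSeqs_zero_cons]
  · have : ∀ l ∈ removables n, ∑ k ∈ addables (n.erase l), numSeqs (m + 1) (k ::ₘ n.erase l) =
        (m + 1) * numSeqs m (n.erase l) := by
      intro l hl
      have hl := mem_removables.1 hl
      apply ih
      have hl' : IsAddable (n.erase l) l := by
        rw [← isRemovable_cons_self, Multiset.cons_erase hl.mem]; exact hl
      rw [← isDiagram_cons hl', Multiset.cons_erase hl.mem]
      exact hn
    rw [Finset.sum_congr rfl this, ← Finset.mul_sum, ← numSeqs_succ]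
    ring

/-- The number of pairs of standard tableaux of the same shape with `m` boxes is `m!`. -/
lemma sum_numSeqs_shape (m : ℕ) : ∑ c ∈ contentSeqs m, numSeqs m (shape c m) = m.factorial := by
  induction m with
  | zero => simp [numSeqs, contentSeqs, shape_zero]
  | succ m ih =>
    rw [sum_contentSeqs_succ, Nat.factorial_succ, ← ih, Finset.mul_sum]
    refine Finset.sum_congr rfl fun c hc => ?_
    simp only [shape_update]
    exact sum_numSeqs_cons m (mem_contentSeqs.1 hc).2.isDiagram

/-! ### Adjacent transpositions of content sequences -/

/-- Interchange the values at `i` and `i + 1`. -/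
def swapSeq (i : ℕ) (c : ℕ → ℤ) : ℕ → ℤ := c ∘ Equiv.swap i (i + 1)

lemma swapSeq_left (i : ℕ) (c : ℕ → ℤ) : swapSeq i c i = c (i + 1) := by simp [swapSeq]

lemma swapSeq_right (i : ℕ) (c : ℕ → ℤ) : swapSeq i c (i + 1) = c i := by simp [swapSeq]

lemma swapSeq_of_ne {i k : ℕ} (c : ℕ → ℤ) (h : k ≠ i) (h' : k ≠ i + 1) :
    swapSeq i c k = c k := by
  simp [swapSeq, Equiv.swap_apply_of_ne_of_ne h h']

lemma swapSeq_swapSeq (i : ℕ) (c : ℕ → ℤ) : swapSeq i (swapSeq i c) = c := by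
  funext k; simp [swapSeq]

lemma shape_swapSeq_of_le {i k : ℕ} (c : ℕ → ℤ) (h : k ≤ i) :
    shape (swapSeq i c) k = shape c k :=
  shape_congr fun _ _ => swapSeq_of_ne c (by omega) (by omega)

lemma shape_swapSeq_of_lt {i k : ℕ} (c : ℕ → ℤ) (h : i + 1 < k) :
    shape (swapSeq i c) k = shape c k := by
  induction k, h using Nat.le_induction with
  | base =>
    rw [shape_succ, shape_succ, shape_succ, shape_succ, swapSeq_left, swapSeq_right,
      shape_swapSeq_of_le c le_rfl, Multiset.cons_swap]
  | succ k hk ih => rw [shape_succ, shape_succ, ih, swapSeq_of_ne c (by omega) (by omega)]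

lemma IsContentSeq.ne_succ {m i : ℕ} {c : ℕ → ℤ} (h : IsContentSeq m c) (hi : i + 1 < m) :
    c i ≠ c (i + 1) := by
  intro he
  have h1 := h i (by omega)
  have h2 := h (i + 1) hi
  rw [shape_succ, ← he] at h2
  exact not_isAddable_cons_self h1 h2

lemma IsContentSeq.swapSeq {m i : ℕ} {c : ℕ → ℤ} (h : IsContentSeq m c) (hi : i + 1 < m)
    (hc : |c i - c (i + 1)| ≠ 1) : IsContentSeq m (swapSeq i c) := by
  have hne := h.ne_succ hi
  have h1 : c i ≠ c (i + 1) + 1 := fun h => hc (by rw [h]; simp)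
  have h2 : c i ≠ c (i + 1) - 1 := fun h => hc (by rw [h]; simp)
  intro k hk
  rcases lt_trichotomy k i with hki | rfl | hki
  · rw [shape_swapSeq_of_le c hki.le, swapSeq_of_ne c (by omega) (by omega)]
    exact h k hk
  · have := h (k + 1) hi
    rw [shape_succ] at this
    rw [swapSeq_left, shape_swapSeq_of_le c le_rfl]
    exact (isAddable_cons_of_far hne.symm (by omega) (by omega)).1 this
  rcases Nat.eq_or_lt_of_le hki with rfl | hki
  · rw [Nat.succ_eq_add_one, swapSeq_right, shape_succ, swapSeq_left, shape_swapSeq_of_le c le_rfl]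
    exact (isAddable_cons_of_far hne h1 h2).2 (h i (by omega))
  · rw [shape_swapSeq_of_lt c hki, swapSeq_of_ne c (by omega) (by omega)]
    exact h k hk

/-- The same content cannot occur twice among three consecutive boxes. -/
lemma IsContentSeq.ne_succ_succ {m i : ℕ} {c : ℕ → ℤ} (h : IsContentSeq m c)
    (hi : i + 2 < m) : c i ≠ c (i + 2) := by
  intro he
  by_cases hc : |c i - c (i + 1)| = 1
  · have h1 := h i (by omega)
    have h2 := h (i + 2) hi
    rw [shape_succ, shape_succ, ← he] at h2
    have hne := h.ne_succ (i := i) (by omega)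
    rw [abs_eq (by simp)] at hc
    obtain ⟨h3, h4⟩ := h1
    obtain ⟨h5, h6⟩ := h2
    rw [bdry_cons_of_ne hne, bdry_cons_self] at h5 h6
    rcases hc with hc | hc
    · rw [bdry_cons_of_ne (by omega), bdry_cons_of_ne (by omega)] at h5
      omega
    · rw [bdry_cons_of_ne (by omega), bdry_cons_of_ne (by omega)] at h6
      omega
  · apply (h.swapSeq (i := i) (by omega) hc).ne_succ (i := i + 1) hi
    rw [swapSeq_right, he, swapSeq_of_ne c (by omega) (by omega)]

/-- An admissible interchange of two neighbouring contents. -/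
def SwapStep (m : ℕ) (c d : ℕ → ℤ) : Prop :=
  ∃ i, i + 1 < m ∧ |c i - c (i + 1)| ≠ 1 ∧ d = swapSeq i c

lemma SwapStep.isContentSeq {m : ℕ} {c d : ℕ → ℤ} (h : SwapStep m c d) (hc : IsContentSeq m c) :
    IsContentSeq m d := by
  obtain ⟨i, hi, h, rfl⟩ := h
  exact hc.swapSeq hi h

lemma isContentSeq_of_reflTransGen {m : ℕ} {c d : ℕ → ℤ}
    (h : Relation.ReflTransGen (SwapStep m) c d) (hc : IsContentSeq m c) : IsContentSeq m d := by
  induction h with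
  | refl => exact hc
  | tail _ h ih => exact h.isContentSeq ih

lemma shape_of_reflTransGen {m k : ℕ} {c d : ℕ → ℤ}
    (h : Relation.ReflTransGen (SwapStep m) c d) (hk : m ≤ k) : shape d k = shape c k := by
  induction h with
  | refl => rfl
  | tail _ h ih =>
    obtain ⟨i, hi, -, rfl⟩ := h
    rw [shape_swapSeq_of_lt _ (by omega), ih]

lemma eq_of_reflTransGen {m k : ℕ} {c d : ℕ → ℤ}
    (h : Relation.ReflTransGen (SwapStep m) c d) (hk : m ≤ k) : d k = c k := by
  induction h with
  | refl => rfl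
  | tail _ h ih =>
    obtain ⟨i, hi, -, rfl⟩ := h
    rw [swapSeq_of_ne _ (by omega) (by omega), ih]

lemma reflTransGen_mono {m m' : ℕ} (hm : m ≤ m') {c d : ℕ → ℤ}
    (h : Relation.ReflTransGen (SwapStep m) c d) : Relation.ReflTransGen (SwapStep m') c d :=
  Relation.ReflTransGen.mono (fun _ _ ⟨i, hi, h⟩ => ⟨i, by omega, h⟩) _ _ h

/-- A removable box can be moved to the end of a content sequence. -/
lemma exists_reflTransGen_last {m : ℕ} {c : ℕ → ℤ} (hc : IsContentSeq (m + 1) c) {l : ℤ}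
    (hl : IsRemovable (shape c (m + 1)) l) :
    ∃ d, Relation.ReflTransGen (SwapStep (m + 1)) c d ∧ d m = l := by
  induction m generalizing c with
  | zero =>
    refine ⟨c, .refl, ?_⟩
    have := hl.mem
    simpa [shape_succ, shape_zero, eq_comm] using this
  | succ m ih =>
    by_cases hlc : c (m + 1) = l
    · exact ⟨c, .refl, hlc⟩
    obtain ⟨hc1, hc2⟩ := isContentSeq_succ.1 hc
    rw [shape_succ] at hl
    obtain ⟨h1, h2⟩ := (isRemovable_cons_self.2 hc2).far hl
    obtain ⟨d, hd, rfl⟩ := ih hc1 ((isRemovable_cons_of_far (Ne.symm hlc) h1 h2).1 hl)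
    refine ⟨swapSeq m d, (reflTransGen_mono (by omega) hd).tail ⟨m, by omega, ?_, rfl⟩,
      swapSeq_right m d⟩
    rw [eq_of_reflTransGen hd le_rfl]
    intro h
    rw [abs_eq (by simp)] at h
    omega

/-- Content sequences of the same shape are connected by admissible interchanges. -/
lemma reflTransGen_of_shape_eq {m : ℕ} {c d : ℕ → ℤ} (hc : IsContentSeq m c)
    (hd : IsContentSeq m d) (h : shape c m = shape d m) (htail : ∀ k, m ≤ k → c k = d k) :
    Relation.ReflTransGen (SwapStep m) c d := by
  induction m generalizing c with
  | zero =>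
    have : c = d := funext fun k => htail k (by omega)
    rw [this]
  | succ m ih =>
    obtain ⟨hd1, hd2⟩ := isContentSeq_succ.1 hd
    have hrem : IsRemovable (shape c (m + 1)) (d m) := by
      rw [h, shape_succ]; exact isRemovable_cons_self.2 hd2
    obtain ⟨e, hce, he⟩ := exists_reflTransGen_last hc hrem
    refine hce.trans (reflTransGen_mono (by omega) (ih ?_ hd1 ?_ ?_))
    · exact (isContentSeq_of_reflTransGen hce hc).mono (by omega)
    · have := shape_of_reflTransGen hce le_rfl
      rw [h, shape_succ, shape_succ, he] at this
      exact (Multiset.cons_inj_right _).1 this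
    · intro k hk
      rcases hk.eq_or_lt with rfl | hk
      · exact he
      · rw [eq_of_reflTransGen hce hk, htail k hk]

/-! ### Content sequences of standard tableaux -/

/-- The number of boxes `(i, j)` of `S` with content `x`, where `S` is closed under passing to
north-west neighbours, is read off from the first box of the diagonal outside `S`. -/
lemma bdry_map_ctn {S : Finset (ℕ × ℕ)}
    (hS : ∀ p ∈ S, ∀ r : ℕ × ℕ, r.1 ≤ p.1 → r.2 ≤ p.2 → r ∈ S) {i j : ℕ} (hout : (i, j) ∉ S)
    (hin : ∀ a b, i = a + 1 → j = b + 1 → (a, b) ∈ S) :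
    bdry (S.val.map ctn) (j - i : ℤ) = i + j := by
  have hcount : (S.val.map ctn).count (j - i : ℤ) = min i j := by
    rw [Multiset.count_map, ← Finset.filter_val, Finset.card_val]
    have : S.filter (fun p => (j - i : ℤ) = ctn p) =
        (Finset.range (min i j)).image fun t => (i - min i j + t, j - min i j + t) := by
      ext ⟨a, b⟩
      rw [Finset.mem_filter, Finset.mem_image]
      simp only [Finset.mem_range, ctn, Prod.mk.injEq]
      constructor
      · rintro ⟨hp, he⟩
        have hlt : a < i := by
          by_contra hle
          exact hout (hS _ hp _ (by simp; omega) (by simp; omega))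
        exact ⟨min a b, by omega, by omega, by omega⟩
      · rintro ⟨t, ht, rfl, rfl⟩
        refine ⟨?_, by push_cast; omega⟩
        refine hS _ (hin (i - 1) (j - 1) (by omega) (by omega)) _ ?_ ?_ <;> simp <;> omega
    rw [this, Finset.card_image_of_injective _ (by intro a b h; simp at h; omega),
      Finset.card_range]
  rw [bdry, hcount]
  rcases abs_cases (j - i : ℤ) with h | h <;> omega

lemma StdTab.le_of_le {μ : YoungDiagram} {m : ℕ} (U : StdTab μ m) {k l : ℕ}
    (hk : k ∈ Set.Icc 1 m) (hl : l ∈ Set.Icc 1 m) (h1 : (U.pos k).1 ≤ (U.pos l).1)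
    (h2 : (U.pos k).2 ≤ (U.pos l).2) : k ≤ l := by
  have hmem : ((U.pos k).1, (U.pos l).2) ∈ μ :=
    μ.up_left_mem h1 le_rfl (U.bij.mapsTo hl)
  obtain ⟨n, hn, hpos⟩ := U.bij.surjOn hmem
  have hkn : k ≤ n := by
    rcases h2.eq_or_lt with h | h
    · exact (U.bij.injOn hk hn (by rw [hpos, ← h])).le
    · exact (U.row_lt k hk n hn (by rw [hpos]) (by rw [hpos]; exact h)).le
  have hnl : n ≤ l := by
    rcases h1.eq_or_lt with h | h
    · exact (U.bij.injOn hn hl (by rw [hpos, h])).le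
    · exact (U.col_lt n hn l hl (by rw [hpos]) (by rw [hpos]; exact h)).le
  exact hkn.trans hnl

/-- The content sequence of a standard tableau, indexed from `0` and extended by zero. -/
def contentSeq {μ : YoungDiagram} {m : ℕ} (U : StdTab μ m) (k : ℕ) : ℤ :=
  if k < m then ctnAt U (k + 1) else 0

lemma contentSeq_mem {μ : YoungDiagram} {m : ℕ} (U : StdTab μ m) :
    contentSeq U ∈ contentSeqs m := by
  rw [mem_contentSeqs]
  refine ⟨fun k hk => if_neg (by omega), fun k hk => ?_⟩
  have hinj : Set.InjOn (fun n => U.pos (n + 1)) (Finset.range k) := by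
    intro a ha b hb h
    simp only [Finset.coe_range, Set.mem_Iio] at ha hb
    have := U.bij.injOn (Set.mem_Icc.2 ⟨by omega, by omega⟩)
      (Set.mem_Icc.2 ⟨by omega, by omega⟩) h
    omega
  have hshape : shape (contentSeq U) k =
      ((Finset.range k).image fun n => U.pos (n + 1)).val.map ctn := by
    rw [Finset.image_val_of_injOn hinj, Multiset.map_map, Finset.range_val]
    refine Multiset.map_congr rfl fun n hn => ?_
    rw [Multiset.mem_range] at hn
    simp only [contentSeq, if_pos (hn.trans hk)]
    rfl
  have hmem : ∀ n ∈ Set.Icc 1 m,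
      (U.pos n ∈ (Finset.range k).image fun n => U.pos (n + 1)) ↔ n ≤ k := by
    intro n hn
    simp only [Finset.mem_image, Finset.mem_range]
    constructor
    · rintro ⟨a, ha, h⟩
      have := U.bij.injOn (Set.mem_Icc.2 ⟨by omega, by omega⟩) hn h
      omega
    · intro h
      obtain ⟨hn1, hn2⟩ := hn
      exact ⟨n - 1, by omega, by rw [Nat.sub_add_cancel hn1]⟩
  rw [hshape]
  set S := (Finset.range k).image fun n => U.pos (n + 1) with hSdef
  have hSμ : ∀ p ∈ S, p ∈ μ := by
    intro p hp
    obtain ⟨n, hn, rfl⟩ := Finset.mem_image.1 hp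
    rw [Finset.mem_range] at hn
    exact U.bij.mapsTo (Set.mem_Icc.2 ⟨by omega, by omega⟩)
  have hS : ∀ p ∈ S, ∀ r : ℕ × ℕ, r.1 ≤ p.1 → r.2 ≤ p.2 → r ∈ S := by
    intro p hp r h1 h2
    obtain ⟨l, hl, rfl⟩ := U.bij.surjOn (hSμ p hp)
    obtain ⟨n, hn, hnr⟩ := U.bij.surjOn (μ.up_left_mem h1 h2 (hSμ _ hp) : (r.1, r.2) ∈ μ)
    obtain rfl : U.pos n = r := hnr
    rw [hmem l hl] at hp
    rw [hmem n hn]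
    exact (U.le_of_le hn hl h1 h2).trans hp
  have hk1 : k + 1 ∈ Set.Icc 1 m := Set.mem_Icc.2 ⟨by omega, by omega⟩
  obtain ⟨i, j, hij⟩ : ∃ i j, U.pos (k + 1) = (i, j) := ⟨_, _, rfl⟩
  have hout : ∀ a b, i ≤ a → j ≤ b → (a, b) ∉ S := by
    intro a b ha hb h
    obtain ⟨l, hl, hlp⟩ := U.bij.surjOn (hSμ _ h)
    rw [← hlp, hmem l hl] at h
    have := U.le_of_le hk1 hl (by rw [hlp, hij]; exact ha) (by rw [hlp, hij]; exact hb)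
    omega
  have hin : ∀ a b, a ≤ i → b ≤ j → (a, b) ≠ (i, j) → (a, b) ∈ S := by
    intro a b ha hb hne
    have hkμ : (i, j) ∈ μ := by rw [← hij]; exact U.bij.mapsTo hk1
    obtain ⟨l, hl, hlp⟩ := U.bij.surjOn (μ.up_left_mem ha hb hkμ)
    rw [← hlp, hmem l hl]
    have := U.le_of_le hl hk1 (by rw [hlp, hij]; exact ha) (by rw [hlp, hij]; exact hb)
    have : l ≠ k + 1 := by rintro rfl; exact hne (by rw [← hlp, hij])
    omega
  have hc : contentSeq U k = j - i := by simp [contentSeq, hk, ctnAt, ctn, hij]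
  rw [hc]
  have h0 := bdry_map_ctn hS (hout i j le_rfl le_rfl)
    (fun a b ha hb => hin a b (by omega) (by omega) (by simp; omega))
  have h1 := bdry_map_ctn hS (hout i (j + 1) le_rfl (by omega))
    (fun a b ha hb => hin a b (by omega) (by omega) (by simp; omega))
  have h2 := bdry_map_ctn hS (hout (i + 1) j (by omega) le_rfl)
    (fun a b ha hb => hin a b (by omega) (by omega) (by simp; omega))
  push_cast at h1 h2
  constructor
  · rw [h0, show (j - i + 1 : ℤ) = j + 1 - i by ring, h1]; ring
  · rw [h0, show (j - i - 1 : ℤ) = j - (i + 1) by ring, h2]; ring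

/-! ### The dimension of the Hecke algebra is at most `m!` -/

/-- The first `N` terms of `t` satisfy the Hecke relations, with `T² = z T + 1`. -/
structure HeckeSeq {A : Type*} [Ring A] [Algebra ℂ A] (z : ℂ) (N : ℕ) (t : ℕ → A) : Prop where
  quad : ∀ i < N, t i * t i = z • t i + 1
  braid : ∀ i, i + 1 < N → t i * t (i + 1) * t i = t (i + 1) * t i * t (i + 1)
  comm : ∀ i j, i + 1 < j → j < N → t i * t j = t j * t i

/-- The product `t k * t (k - 1) * ⋯` of `n` factors. -/
def descProd {A : Type*} [Ring A] (t : ℕ → A) (k : ℕ) : ℕ → A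
  | 0 => 1
  | n + 1 => descProd t k n * t (k - n)

namespace HeckeSeq

variable {A : Type*} [Ring A] [Algebra ℂ A] {z : ℂ} {N : ℕ} {t : ℕ → A}

lemma descProd_mul_of_lt (h : HeckeSeq z N t) {k : ℕ} (hk : k < N) {n i : ℕ} (hi : i + n < k) :
    descProd t k n * t i = t i * descProd t k n := by
  induction n with
  | zero => simp [descProd]
  | succ n ih =>
    rw [descProd, mul_assoc, ← h.comm i (k - n) (by omega) (by omega), ← mul_assoc,
      ih (by omega), mul_assoc]

lemma descProd_mul_self (h : HeckeSeq z N t) {k : ℕ} (hk : k < N) (n : ℕ) :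
    descProd t k (n + 1) * t (k - n) = z • descProd t k (n + 1) + descProd t k n := by
  rw [descProd, mul_assoc, h.quad _ (by omega), mul_add, mul_one, mul_smul_comm]

lemma descProd_mul_of_gt (h : HeckeSeq z N t) {k : ℕ} (hk : k < N) {n i : ℕ} (hn : n ≤ k + 1)
    (hi : k + 1 < i + n) (hik : i ≤ k) :
    descProd t k n * t i = t (i - 1) * descProd t k n := by
  induction n with
  | zero => omega
  | succ n ih =>
    rcases Nat.lt_or_ge (k + 1) (i + n) with hlt | hge
    · rw [descProd, mul_assoc, h.comm (k - n) i (by omega) (by omega), ← mul_assoc,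
        ih (by omega) hlt, mul_assoc]
    · obtain ⟨n, rfl⟩ : ∃ n', n = n' + 1 := ⟨n - 1, by omega⟩
      obtain ⟨i, rfl⟩ : ∃ i', i = i' + 1 := ⟨i - 1, by omega⟩
      have e1 : k - n = i + 1 := by omega
      have e2 : k - (n + 1) = i := by omega
      rw [descProd, descProd, e1, e2, Nat.add_sub_cancel, mul_assoc, mul_assoc,
        ← mul_assoc (t (i + 1)), ← h.braid i (by omega), ← mul_assoc, ← mul_assoc,
        h.descProd_mul_of_lt hk (by omega)]
      simp only [mul_assoc]

lemma adjoin_succ_le (h : HeckeSeq z N t) {k : ℕ} (hk : k < N) :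
    Subalgebra.toSubmodule (Algebra.adjoin ℂ (t '' Set.Iio (k + 1))) ≤
      Subalgebra.toSubmodule (Algebra.adjoin ℂ (t '' Set.Iio k)) *
        Submodule.span ℂ (descProd t k '' Set.Iio (k + 2)) := by
  set S := Algebra.adjoin ℂ (t '' Set.Iio k) with hS
  set X := Subalgebra.toSubmodule S * Submodule.span ℂ (descProd t k '' Set.Iio (k + 2)) with hX
  have mem : ∀ s ∈ S, ∀ n < k + 2, s * descProd t k n ∈ X := fun s hs n hn =>
    Submodule.mul_mem_mul hs (Submodule.subset_span ⟨n, hn, rfl⟩)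
  have gen : ∀ i < k, t i ∈ S := fun i hi => Algebra.subset_adjoin ⟨i, hi, rfl⟩
  have step : ∀ i < k + 1, ∀ x ∈ X, x * t i ∈ X := by
    intro i hi
    suffices X ≤ X.comap (LinearMap.mulRight ℂ (t i)) from fun x hx => this hx
    rw [hX, Submodule.mul_le, ← hX]
    intro s hs
    suffices Submodule.span ℂ (descProd t k '' Set.Iio (k + 2)) ≤
        X.comap (LinearMap.mulRight ℂ (t i) ∘ₗ LinearMap.mulLeft ℂ s) from fun x hx => this hx
    rw [Submodule.span_le]
    rintro _ ⟨n, hn, rfl⟩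
    rw [Set.mem_Iio] at hn
    simp only [Submodule.comap_coe, Set.mem_preimage, LinearMap.comp_apply,
      LinearMap.mulRight_apply, LinearMap.mulLeft_apply, SetLike.mem_coe, mul_assoc]
    rcases lt_trichotomy (i + n) k with hlt | heq | hgt
    · rw [h.descProd_mul_of_lt hk hlt, ← mul_assoc]
      exact mem _ (S.mul_mem hs (gen i (by omega))) n hn
    · obtain rfl : i = k - n := by omega
      exact mem s hs (n + 1) (by omega)
    by_cases hi0 : k < i + n
    · rcases Nat.lt_or_ge (k + 1) (i + n) with hlt | hge
      · rw [h.descProd_mul_of_gt hk (by omega) hlt (by omega), ← mul_assoc]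
        exact mem _ (S.mul_mem hs (gen _ (by omega))) n hn
      · obtain ⟨n, rfl⟩ : ∃ n', n = n' + 1 := ⟨n - 1, by omega⟩
        obtain rfl : i = k - n := by omega
        rw [h.descProd_mul_self hk, mul_add, mul_smul_comm]
        exact X.add_mem (X.smul_mem _ (mem s hs _ hn)) (mem s hs n (by omega))
    · omega
  rw [Algebra.adjoin_eq_span, Submodule.span_le]
  intro x hx
  induction hx using Submonoid.closure_induction_right with
  | one => simpa [descProd] using mem 1 S.one_mem 0 (by omega)
  | mul_right x hx y hy ih =>
    obtain ⟨i, hi, rfl⟩ := hy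
    exact step i hi x ih

lemma exists_finset_span (h : HeckeSeq z N t) {k : ℕ} (hk : k ≤ N) :
    ∃ s : Finset A, s.card ≤ (k + 1).factorial ∧
      Subalgebra.toSubmodule (Algebra.adjoin ℂ (t '' Set.Iio k)) ≤ Submodule.span ℂ (s : Set A) := by
  induction k with
  | zero =>
    refine ⟨{1}, by simp, ?_⟩
    rw [show Set.Iio 0 = (∅ : Set ℕ) by ext; simp, Set.image_empty, Algebra.adjoin_empty,
      Algebra.toSubmodule_bot, Submodule.one_eq_span]
    simp
  | succ k ih =>
    obtain ⟨s, hs, hspan⟩ := ih (by omega)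
    refine ⟨Finset.image₂ (· * ·) s ((Finset.range (k + 2)).image (descProd t k)), ?_, ?_⟩
    · rw [Nat.factorial_succ, mul_comm]
      refine (Finset.card_image₂_le _ _ _).trans (Nat.mul_le_mul hs ?_)
      exact Finset.card_image_le.trans (by simp)
    · refine (h.adjoin_succ_le (by omega)).trans ?_
      rw [Finset.coe_image₂, Set.image2_mul, ← Submodule.span_mul_span]
      refine mul_le_mul' hspan (Submodule.span_mono ?_)
      simp

end HeckeSeq

section

variable {q : ℂ}

lemma tgen_quad (hq : q ≠ 0) {m : ℕ} (i : Fin (m - 1)) :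
    Tgen q m i * Tgen q m i = (q - q⁻¹) • Tgen q m i + 1 := by
  have := RingQuot.mkAlgHom_rel ℂ (HeckeRel.quad (q := q) i)
  simp only [map_mul, map_sub, map_add, map_zero, AlgHom.commutes] at this
  change (Tgen q m i - _) * (Tgen q m i + _) = 0 at this
  rw [Algebra.algebraMap_eq_smul_one, Algebra.algebraMap_eq_smul_one] at this
  rw [← sub_eq_zero, ← this]
  simp only [sub_mul, mul_add, smul_mul_assoc, mul_smul_comm, one_mul, mul_one]
  match_scalars <;> field_simp
  ring

lemma heckeSeq_tn (hq : q ≠ 0) (m : ℕ) : HeckeSeq (q - q⁻¹) (m - 1) (Tn q m) where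
  quad i hi := by
    simp only [Tn, hi, dif_pos]
    exact tgen_quad hq _
  braid i hi := by
    simp only [Tn, hi, dif_pos, show i < m - 1 by omega]
    simpa only [map_mul, Tgen] using RingQuot.mkAlgHom_rel ℂ
      (HeckeRel.braid (q := q) (m := m) ⟨i, by omega⟩ ⟨i + 1, hi⟩ rfl)
  comm i j hij hj := by
    simp only [Tn, hj, dif_pos, show i < m - 1 by omega]
    simpa only [map_mul, Tgen] using RingQuot.mkAlgHom_rel ℂ
      (HeckeRel.commute (q := q) (m := m) ⟨i, by omega⟩ ⟨j, hj⟩ hij)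

lemma adjoin_tn (m : ℕ) : Algebra.adjoin ℂ (Tn q m '' Set.Iio (m - 1)) = ⊤ := by
  have h1 : Tn q m '' Set.Iio (m - 1) =
      RingQuot.mkAlgHom ℂ (HeckeRel q m) '' Set.range (FreeAlgebra.ι ℂ) := by
    ext x
    constructor
    · rintro ⟨i, hi, rfl⟩
      exact ⟨_, ⟨⟨i, hi⟩, rfl⟩, by rw [Tn, dif_pos (Set.mem_Iio.1 hi)]; rfl⟩
    · rintro ⟨_, ⟨i, rfl⟩, rfl⟩
      exact ⟨i, i.2, by rw [Tn, dif_pos i.2]; rfl⟩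
  rw [h1, ← AlgHom.map_adjoin, FreeAlgebra.adjoin_range_ι, Algebra.map_top,
    AlgHom.range_eq_top]
  exact RingQuot.mkAlgHom_surjective ℂ _

lemma exists_finset_span_hecke (hq : q ≠ 0) {m : ℕ} (hm : 1 ≤ m) :
    ∃ s : Finset (Hecke q m), s.card ≤ m.factorial ∧ Submodule.span ℂ (s : Set (Hecke q m)) = ⊤ := by
  obtain ⟨s, hs, hspan⟩ := (heckeSeq_tn hq m).exists_finset_span le_rfl
  rw [adjoin_tn, Algebra.top_toSubmodule, top_le_iff] at hspan
  exact ⟨s, by rwa [Nat.sub_add_cancel hm] at hs, hspan⟩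

lemma finite_hecke (hq : q ≠ 0) {m : ℕ} (hm : 1 ≤ m) : Module.Finite ℂ (Hecke q m) := by
  obtain ⟨s, -, hs⟩ := exists_finset_span_hecke hq hm
  exact ⟨⟨s, hs⟩⟩

lemma finrank_hecke_le (hq : q ≠ 0) {m : ℕ} (hm : 1 ≤ m) :
    Module.finrank ℂ (Hecke q m) ≤ m.factorial := by
  obtain ⟨s, hs, hspan⟩ := exists_finset_span_hecke hq hm
  have := finrank_span_finset_le_card (R := ℂ) s
  rw [Set.finrank, hspan, finrank_top] at this
  exact this.trans hs

end

/-! ### The seminormal form -/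

/-- The diagonal coefficient of the seminormal form for neighbouring contents `x`, `y`. -/
def diagCoeff (q : ℂ) (x y : ℤ) : ℂ := (q - q⁻¹) * q ^ (2 * y) / (q ^ (2 * y) - q ^ (2 * x))

/-- The off-diagonal coefficient of the seminormal form for neighbouring contents `x`, `y`. -/
def offCoeff (q : ℂ) (x y : ℤ) : ℂ := if |x - y| = 1 then 0 else q - diagCoeff q x y

section Coefficients

variable {q : ℂ} {x y z : ℤ}

lemma zpow_two_mul_injective (hq : q ≠ 0) (hq' : NotRootOfUnity q) :
    Function.Injective fun x : ℤ => q ^ (2 * x) := by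
  have key : ∀ x y : ℤ, x < y → q ^ (2 * x) ≠ q ^ (2 * y) := by
    intro x y hxy h
    have h1 : q ^ (2 * (y - x)) = 1 := by
      rw [mul_sub, zpow_sub₀ hq, h, div_self (zpow_ne_zero _ hq)]
    refine hq' (2 * (y - x)).toNat (by omega) ?_
    rw [← h1, ← zpow_natCast, Int.toNat_of_nonneg (by omega)]
  intro x y h
  rcases lt_trichotomy x y with hlt | heq | hgt
  · exact absurd h (key x y hlt)
  · exact heq
  · exact absurd h.symm (key y x hgt)

lemma zpow_sub_ne_zero (hq : q ≠ 0) (hq' : NotRootOfUnity q) (h : x ≠ y) :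
    q ^ (2 * x) - q ^ (2 * y) ≠ 0 :=
  sub_ne_zero.2 fun he => h (zpow_two_mul_injective hq hq' he)

lemma diagCoeff_add (hq : q ≠ 0) (hq' : NotRootOfUnity q) (h : x ≠ y) :
    diagCoeff q x y + diagCoeff q y x = q - q⁻¹ := by
  have h1 := zpow_sub_ne_zero hq hq' h
  have h2 := zpow_sub_ne_zero hq hq' h.symm
  unfold diagCoeff
  generalize q ^ (2 * x) = X at *
  generalize q ^ (2 * y) = Y at *
  generalize q - q⁻¹ = w
  field_simp
  ring

lemma diagCoeff_eq_of_sub_eq_one (hq : q ≠ 0) (hq' : NotRootOfUnity q) (h : y = x + 1) :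
    diagCoeff q x y = q := by
  have h1 := zpow_sub_ne_zero hq hq' (show y ≠ x by omega)
  subst h
  unfold diagCoeff
  rw [div_eq_iff h1, mul_add, zpow_add₀ hq]
  norm_num
  field_simp

lemma offCoeff_mul (hq : q ≠ 0) (hq' : NotRootOfUnity q) (h : x ≠ y) :
    offCoeff q x y * offCoeff q y x = (q - diagCoeff q x y) * (q⁻¹ + diagCoeff q x y) := by
  have hadd := diagCoeff_add hq hq' h
  unfold offCoeff
  rw [abs_sub_comm y x]
  split_ifs with h1
  · rcases (abs_eq zero_le_one).1 h1 with h1 | h1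
    · have := diagCoeff_eq_of_sub_eq_one hq hq' (show x = y + 1 by omega)
      linear_combination (-(q - diagCoeff q x y)) * (hadd - this)
    · rw [diagCoeff_eq_of_sub_eq_one hq hq' (show y = x + 1 by omega)]
      ring
  · linear_combination (-(q - diagCoeff q x y)) * hadd

lemma offCoeff_ne_zero (hq : q ≠ 0) (hq' : NotRootOfUnity q) (h : x ≠ y) (h1 : |x - y| ≠ 1) :
    offCoeff q x y ≠ 0 := by
  have hxy := zpow_sub_ne_zero hq hq' h.symm
  have hne := zpow_sub_ne_zero hq hq' (show y - 1 ≠ x by intro h; apply h1; rw [← h]; simp)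
  rw [offCoeff, if_neg h1]
  intro h0
  apply hne
  rw [diagCoeff, sub_eq_zero, eq_div_iff hxy] at h0
  rw [mul_sub, zpow_sub₀ hq]
  norm_num
  field_simp at h0 ⊢
  linear_combination h0

lemma diagCoeff_braid (hq : q ≠ 0) (hq' : NotRootOfUnity q) (hxy : x ≠ y) (hxz : x ≠ z)
    (hyz : y ≠ z) :
    diagCoeff q x z * diagCoeff q y x + diagCoeff q x y * diagCoeff q y z =
      diagCoeff q y z * diagCoeff q x z := by
  have h1 := zpow_sub_ne_zero hq hq' hxy.symm
  have h2 := zpow_sub_ne_zero hq hq' hxz.symm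
  have h3 := zpow_sub_ne_zero hq hq' hyz.symm
  have h4 := zpow_sub_ne_zero hq hq' hxy
  unfold diagCoeff
  generalize q ^ (2 * x) = X at *
  generalize q ^ (2 * y) = Y at *
  generalize q ^ (2 * z) = Z at *
  generalize q - q⁻¹ = w
  field_simp
  ring

lemma zpow_mul_diagCoeff (hq : q ≠ 0) (hq' : NotRootOfUnity q) (h : x ≠ y) :
    (q - q⁻¹ - diagCoeff q x y) * q ^ (2 * y) + diagCoeff q x y * q ^ (2 * x) = 0 := by
  have h1 := zpow_sub_ne_zero hq hq' h.symm
  unfold diagCoeff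
  generalize q ^ (2 * x) = X at *
  generalize q ^ (2 * y) = Y at *
  generalize q - q⁻¹ = w
  field_simp
  ring

end Coefficients

/-- The seminormal action of the `i`-th generator on all functions of integer sequences. -/
def seqOp (q : ℂ) (i : ℕ) : ((ℕ → ℤ) → ℂ) →ₗ[ℂ] ((ℕ → ℤ) → ℂ) where
  toFun F c := diagCoeff q (c i) (c (i + 1)) * F c +
    offCoeff q (c i) (c (i + 1)) * F (swapSeq i c)
  map_add' F G := by funext c; simp only [Pi.add_apply]; ring
  map_smul' a F := by
    funext c; simp only [Pi.smul_apply, smul_eq_mul, RingHom.id_apply]; ring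

lemma seqOp_apply (q : ℂ) (i : ℕ) (F : (ℕ → ℤ) → ℂ) (c : ℕ → ℤ) :
    seqOp q i F c = diagCoeff q (c i) (c (i + 1)) * F c +
      offCoeff q (c i) (c (i + 1)) * F (swapSeq i c) := rfl

section SeqOp

variable {q : ℂ}

lemma seqOp_quad (hq : q ≠ 0) (hq' : NotRootOfUnity q) (i : ℕ) (F : (ℕ → ℤ) → ℂ)
    {c : ℕ → ℤ} (hc : c i ≠ c (i + 1)) :
    seqOp q i (seqOp q i F) c = (q - q⁻¹) * seqOp q i F c + F c := by
  simp only [seqOp_apply, swapSeq_left, swapSeq_right, swapSeq_swapSeq]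
  linear_combination F c * offCoeff_mul hq hq' hc +
    offCoeff q (c i) (c (i + 1)) * F (swapSeq i c) * diagCoeff_add hq hq' hc +
    F c * mul_inv_cancel₀ hq

lemma swapSeq_comm {i j : ℕ} (hij : i + 1 < j) (c : ℕ → ℤ) :
    swapSeq i (swapSeq j c) = swapSeq j (swapSeq i c) := by
  funext k
  simp only [swapSeq, Function.comp_apply, Equiv.swap_apply_def]
  congr 1
  split_ifs <;> omega

lemma swapSeq_braid (i : ℕ) (c : ℕ → ℤ) :
    swapSeq i (swapSeq (i + 1) (swapSeq i c)) =
      swapSeq (i + 1) (swapSeq i (swapSeq (i + 1) c)) := by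
  funext k
  simp only [swapSeq, Function.comp_apply, Equiv.swap_apply_def]
  congr 1
  split_ifs <;> omega

lemma seqOp_comm {i j : ℕ} (hij : i + 1 < j) (F : (ℕ → ℤ) → ℂ) :
    seqOp q i (seqOp q j F) = seqOp q j (seqOp q i F) := by
  funext c
  simp only [seqOp_apply]
  rw [swapSeq_of_ne (i := i) (k := j) c (by omega) (by omega),
    swapSeq_of_ne (i := i) (k := j + 1) c (by omega) (by omega),
    swapSeq_of_ne (i := j) (k := i) c (by omega) (by omega),
    swapSeq_of_ne (i := j) (k := i + 1) c (by omega) (by omega), swapSeq_comm hij]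
  ring

lemma seqOp_braid (hq : q ≠ 0) (hq' : NotRootOfUnity q) (i : ℕ) (F : (ℕ → ℤ) → ℂ)
    {c : ℕ → ℤ} (h01 : c i ≠ c (i + 1)) (h02 : c i ≠ c (i + 2))
    (h12 : c (i + 1) ≠ c (i + 2)) :
    seqOp q i (seqOp q (i + 1) (seqOp q i F)) c =
      seqOp q (i + 1) (seqOp q i (seqOp q (i + 1) F)) c := by
  have r1 : ∀ d : ℕ → ℤ, swapSeq (i + 1) d i = d i := fun d =>
    swapSeq_of_ne d (by omega) (by omega)
  have r2 : ∀ d : ℕ → ℤ, swapSeq i d (i + 1 + 1) = d (i + 1 + 1) := fun d =>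
    swapSeq_of_ne d (by omega) (by omega)
  simp only [seqOp_apply, swapSeq_left, swapSeq_right, swapSeq_swapSeq, r1, r2, swapSeq_braid]
  rw [show i + 2 = i + 1 + 1 from rfl] at h02 h12
  generalize c i = x at *
  generalize c (i + 1) = y at *
  generalize c (i + 1 + 1) = z at *
  have e1 := diagCoeff_braid hq hq' h01 h02 h12
  have e2 := offCoeff_mul hq hq' h01
  have e3 := offCoeff_mul hq hq' h12
  have e4 := diagCoeff_add hq hq' h01
  have e5 := diagCoeff_add hq hq' h12
  generalize diagCoeff q x y = axy at *
  generalize diagCoeff q y z = ayz at *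
  generalize diagCoeff q x z = axz at *
  generalize diagCoeff q y x = ayx at *
  generalize diagCoeff q z y = azy at *
  linear_combination F c * (axz * e2 - axz * e3) + F c * (axy - ayz) * (e1 - axz * e4) +
    offCoeff q x y * F (swapSeq i c) * e1 +
    offCoeff q y z * F (swapSeq (i + 1) c) * (axz * e4 - axz * e5 - e1)

lemma seqOp_zpow_seqOp (hq : q ≠ 0) (hq' : NotRootOfUnity q) (i : ℕ) (F : (ℕ → ℤ) → ℂ)
    {c : ℕ → ℤ} (hc : c i ≠ c (i + 1)) :
    seqOp q i (fun d => q ^ (2 * d i) * seqOp q i F d) c = q ^ (2 * c (i + 1)) * F c := by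
  simp only [seqOp_apply, swapSeq_left, swapSeq_right, swapSeq_swapSeq]
  have e1 := offCoeff_mul hq hq' hc
  have e2 := diagCoeff_add hq hq' hc
  have e3 := zpow_mul_diagCoeff hq hq' hc
  linear_combination F c * q ^ (2 * c (i + 1)) * e1 +
    offCoeff q (c i) (c (i + 1)) * F (swapSeq i c) * q ^ (2 * c (i + 1)) * e2 +
    (offCoeff q (c i) (c (i + 1)) * F (swapSeq i c) + F c * diagCoeff q (c i) (c (i + 1))) * e3 +
    F c * q ^ (2 * c (i + 1)) * mul_inv_cancel₀ hq

end SeqOp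

/-! ### The seminormal representation of the Hecke algebra -/

/-- Extension by zero of a function of content sequences. -/
def extZero (m : ℕ) : (contentSeqs m → ℂ) →ₗ[ℂ] ((ℕ → ℤ) → ℂ) where
  toFun f c := if h : c ∈ contentSeqs m then f ⟨c, h⟩ else 0
  map_add' f g := by funext c; simp only [Pi.add_apply]; split_ifs <;> simp
  map_smul' a f := by funext c; simp only [Pi.smul_apply, RingHom.id_apply]; split_ifs <;> simp

lemma extZero_coe {m : ℕ} (f : contentSeqs m → ℂ) (c : contentSeqs m) : extZero m f c = f c :=
  dif_pos c.2

lemma extZero_of_notMem {m : ℕ} (f : contentSeqs m → ℂ) {c : ℕ → ℤ} (hc : c ∉ contentSeqs m) :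
    extZero m f c = 0 := dif_neg hc

/-- The seminormal action of the `i`-th generator on functions of content sequences. -/
def genOp (q : ℂ) (m i : ℕ) : Module.End ℂ (contentSeqs m → ℂ) :=
  LinearMap.funLeft ℂ ℂ Subtype.val ∘ₗ seqOp q i ∘ₗ extZero m

lemma genOp_apply (q : ℂ) {m : ℕ} (i : ℕ) (f : contentSeqs m → ℂ) (c : contentSeqs m) :
    genOp q m i f c = seqOp q i (extZero m f) c := rfl

lemma swapSeq_mem {m i : ℕ} (hi : i + 1 < m) {c : ℕ → ℤ} (hc : c ∈ contentSeqs m)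
    (h : |c i - c (i + 1)| ≠ 1) : swapSeq i c ∈ contentSeqs m := by
  rw [mem_contentSeqs] at hc ⊢
  refine ⟨fun k hk => ?_, hc.2.swapSeq hi h⟩
  rw [swapSeq_of_ne c (by omega) (by omega), hc.1 k hk]

lemma extZero_genOp (q : ℂ) {m i : ℕ} (hi : i + 1 < m) (f : contentSeqs m → ℂ) :
    extZero m (genOp q m i f) = seqOp q i (extZero m f) := by
  funext c
  by_cases hc : c ∈ contentSeqs m
  · exact extZero_coe _ ⟨c, hc⟩
  rw [extZero_of_notMem _ hc, seqOp_apply, extZero_of_notMem _ hc, mul_zero, zero_add, eq_comm,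
    mul_eq_zero]
  by_cases h : |c i - c (i + 1)| = 1
  · exact Or.inl (if_pos h)
  · refine Or.inr (extZero_of_notMem _ fun hs => hc ?_)
    rw [← swapSeq_swapSeq i c]
    refine swapSeq_mem hi hs ?_
    rwa [swapSeq_left, swapSeq_right, abs_sub_comm]

lemma ne_succ_of_mem {m i : ℕ} (hi : i + 1 < m) (c : contentSeqs m) : c.1 i ≠ c.1 (i + 1) :=
  (mem_contentSeqs.1 c.2).2.ne_succ hi

/-- The eigenvalue `q ^ (2 c_k)` of the Jucys–Murphy element `y_{k+1}`, as a function of `c`. -/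
def jmOp (q : ℂ) (m k : ℕ) : contentSeqs m → ℂ := fun c => q ^ (2 * c.1 k)

lemma extZero_jmOp_mul (q : ℂ) {m : ℕ} (k : ℕ) (f : contentSeqs m → ℂ) :
    extZero m (jmOp q m k * f) = fun c => q ^ (2 * c k) * extZero m f c := by
  funext c
  by_cases hc : c ∈ contentSeqs m
  · simp only [extZero, LinearMap.coe_mk, AddHom.coe_mk, dif_pos hc]
    rfl
  · rw [extZero_of_notMem _ hc, extZero_of_notMem _ hc, mul_zero]

section

variable {q : ℂ} {m : ℕ}

lemma genOp_quad (hq : q ≠ 0) (hq' : NotRootOfUnity q) {i : ℕ} (hi : i + 1 < m) :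
    genOp q m i * genOp q m i = (q - q⁻¹) • genOp q m i + 1 := by
  refine LinearMap.ext fun f => funext fun c => ?_
  simp only [Module.End.mul_apply, LinearMap.add_apply, LinearMap.smul_apply, Pi.add_apply,
    Pi.smul_apply, smul_eq_mul, Module.End.one_apply, genOp_apply, extZero_genOp q hi]
  rw [seqOp_quad hq hq' i _ (ne_succ_of_mem hi c), extZero_coe]

lemma genOp_braid (hq : q ≠ 0) (hq' : NotRootOfUnity q) {i : ℕ} (hi : i + 2 < m) :
    genOp q m i * genOp q m (i + 1) * genOp q m i =
      genOp q m (i + 1) * genOp q m i * genOp q m (i + 1) := by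
  refine LinearMap.ext fun f => funext fun c => ?_
  simp only [Module.End.mul_apply, genOp_apply, extZero_genOp q hi,
    extZero_genOp q (show i + 1 < m by omega)]
  exact seqOp_braid hq hq' i _ (ne_succ_of_mem (by omega) c)
    ((mem_contentSeqs.1 c.2).2.ne_succ_succ hi) (ne_succ_of_mem hi c)

lemma genOp_comm {i j : ℕ} (hij : i + 1 < j) (hj : j + 1 < m) :
    genOp q m i * genOp q m j = genOp q m j * genOp q m i := by
  refine LinearMap.ext fun f => funext fun c => ?_
  simp only [Module.End.mul_apply, genOp_apply, extZero_genOp q hj,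
    extZero_genOp q (show i + 1 < m by omega), seqOp_comm hij]

/-- The matrix of the `i`-th generator in the seminormal form. -/
def genMat (q : ℂ) (m i : ℕ) : Matrix (contentSeqs m) (contentSeqs m) ℂ :=
  LinearMap.toMatrixAlgEquiv' (genOp q m i)

lemma genMat_apply (i : ℕ) (c d : contentSeqs m) :
    genMat q m i c d = seqOp q i (extZero m (Pi.single d 1)) c := by
  rw [genMat, LinearMap.toMatrixAlgEquiv'_apply, ← genOp_apply]

lemma genMat_mul_diagonal_mul (hq : q ≠ 0) (hq' : NotRootOfUnity q) {i : ℕ} (hi : i + 1 < m) :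
    genMat q m i * Matrix.diagonal (jmOp q m i) * genMat q m i =
      Matrix.diagonal (jmOp q m (i + 1)) := by
  apply LinearMap.toMatrixAlgEquiv'.symm.injective
  refine LinearMap.ext fun f => funext fun c => ?_
  have h : genOp q m i (jmOp q m i * genOp q m i f) c = jmOp q m (i + 1) c * f c := by
    rw [genOp_apply, extZero_jmOp_mul, extZero_genOp q hi,
      seqOp_zpow_seqOp hq hq' i _ (ne_succ_of_mem hi c), extZero_coe]
    rfl
  have hd : ∀ k, LinearMap.toMatrixAlgEquiv'.symm (Matrix.diagonal (jmOp q m k)) =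
      LinearMap.mulLeft ℂ (jmOp q m k) := fun k => by
    refine LinearMap.ext fun f => funext fun c => ?_
    rw [LinearMap.toMatrixAlgEquiv'_symm, Matrix.toLinAlgEquiv'_apply, Matrix.mulVec_diagonal]
    rfl
  rw [map_mul, map_mul, hd, hd, genMat, AlgEquiv.symm_apply_apply]
  exact h

/-- The seminormal representation of the Hecke algebra. -/
def seminormal (hq : q ≠ 0) (hq' : NotRootOfUnity q) (m : ℕ) :
    Hecke q m →ₐ[ℂ] Matrix (contentSeqs m) (contentSeqs m) ℂ :=
  RingQuot.liftAlgHom ℂ ⟨FreeAlgebra.lift ℂ fun i : Fin (m - 1) => genMat q m i, by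
    intro x y h
    cases h with
    | quad i =>
      have h := genOp_quad hq hq' (show (i : ℕ) + 1 < m by omega)
      simp only [map_mul, map_sub, map_add, map_zero, AlgHom.commutes, FreeAlgebra.lift_ι_apply]
      have h : genMat q m i * genMat q m i = (q - q⁻¹) • genMat q m i + 1 := by
        simpa only [genMat, map_mul, map_add, map_one, map_smul] using
          congrArg LinearMap.toMatrixAlgEquiv' h
      simp only [Algebra.algebraMap_eq_smul_one, sub_mul, mul_add, h, smul_mul_assoc,
        mul_smul_comm, one_mul, mul_one]
      match_scalars <;> field_simp <;> ring
    | braid i j hij =>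
      have h := genOp_braid hq hq' (show (i : ℕ) + 2 < m by omega)
      simp only [map_mul, FreeAlgebra.lift_ι_apply, hij]
      simpa only [genMat, map_mul] using congrArg LinearMap.toMatrixAlgEquiv' h
    | commute i j hij =>
      have h := genOp_comm (q := q) hij (show (j : ℕ) + 1 < m by omega)
      simp only [map_mul, FreeAlgebra.lift_ι_apply]
      simpa only [genMat, map_mul] using congrArg LinearMap.toMatrixAlgEquiv' h⟩

lemma seminormal_tn (hq : q ≠ 0) (hq' : NotRootOfUnity q) {k : ℕ} (hk : k + 1 < m) :
    seminormal hq hq' m (Tn q m k) = genMat q m k := by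
  rw [Tn, dif_pos (show k < m - 1 by omega), Tgen, seminormal, RingQuot.liftAlgHom_mkAlgHom_apply,
    FreeAlgebra.lift_ι_apply]

lemma seminormal_yJM (hq : q ≠ 0) (hq' : NotRootOfUnity q) {k : ℕ} (hk : k < m) :
    seminormal hq hq' m (yJM q m (k + 1)) = Matrix.diagonal (jmOp q m k) := by
  induction k with
  | zero =>
    rw [yJM, map_one, ← Matrix.diagonal_one]
    congr 1
    funext c
    have h := (mem_contentSeqs.1 c.2).2 0 hk
    have : c.1 0 = 0 := by
      simp only [shape_zero, IsAddable, bdry, Multiset.count_zero] at h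
      rcases abs_cases (c.1 0) with h1 | h1 <;> rcases abs_cases (c.1 0 + 1) with h2 | h2 <;>
        rcases abs_cases (c.1 0 - 1) with h3 | h3 <;> omega
    simp [jmOp, this]
  | succ k ih =>
    rw [yJM, map_mul, map_mul, ih (by omega), Tp, Nat.add_sub_cancel, seminormal_tn hq hq' hk,
      genMat_mul_diagonal_mul hq hq' hk]

end

/-! ### Faithfulness of the seminormal representation -/

section

variable {q : ℂ} {m : ℕ}

lemma exists_ne_of_ne {c d : contentSeqs m} (h : d ≠ c) : ∃ k < m, d.1 k ≠ c.1 k := by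
  by_contra! hk
  refine h (Subtype.ext (funext fun k => ?_))
  rcases Nat.lt_or_ge k m with hkm | hkm
  · exact hk k hkm
  · rw [(mem_contentSeqs.1 c.2).1 k hkm, (mem_contentSeqs.1 d.2).1 k hkm]

lemma single_self_mem_range (hq : q ≠ 0) (hq' : NotRootOfUnity q) (c : contentSeqs m) :
    Matrix.single c c (1 : ℂ) ∈ (seminormal hq hq' m).range := by
  set D := (seminormal hq hq' m).range.comap (Matrix.diagonalAlgHom ℂ) with hD
  have jm_mem : ∀ k < m, jmOp q m k ∈ D := fun k hk => ⟨_, seminormal_yJM hq hq' hk⟩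
  suffices Pi.single c (1 : ℂ) ∈ D by
    rw [← Matrix.diagonal_single]
    exact this
  have sep : ∀ d : contentSeqs m, ∃ g ∈ D, g c = 1 ∧ (d ≠ c → g d = 0) := by
    intro d
    by_cases h : d = c
    · exact ⟨1, one_mem D, rfl, fun h' => absurd h h'⟩
    obtain ⟨k, hk, hne⟩ := exists_ne_of_ne h
    have h0 := zpow_sub_ne_zero hq hq' hne.symm
    refine ⟨(q ^ (2 * c.1 k) - q ^ (2 * d.1 k))⁻¹ •
      (jmOp q m k - algebraMap ℂ _ (q ^ (2 * d.1 k))), ?_, ?_, fun _ => ?_⟩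
    · exact D.smul_mem (D.sub_mem (jm_mem k hk) (D.algebraMap_mem _)) _
    · simpa [jmOp] using inv_mul_cancel₀ h0
    · simp [jmOp]
  choose g hgD hgc hgd using sep
  have hprod : Pi.single c (1 : ℂ) = ∏ d, g d := by
    funext e
    rw [Finset.prod_apply]
    by_cases h : e = c
    · subst h
      simp [hgc]
    · rw [Pi.single_eq_of_ne h, eq_comm]
      exact Finset.prod_eq_zero (Finset.mem_univ e) (hgd e h)
  rw [hprod]
  exact D.prod_mem fun d _ => hgD d

lemma single_mem_range (hq : q ≠ 0) (hq' : NotRootOfUnity q) {c d : contentSeqs m}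
    (h : shape c.1 m = shape d.1 m) :
    Matrix.single c d (1 : ℂ) ∈ (seminormal hq hq' m).range := by
  have hc := mem_contentSeqs.1 c.2
  have hd := mem_contentSeqs.1 d.2
  suffices ∀ e, Relation.ReflTransGen (SwapStep m) c.1 e → ∃ he : e ∈ contentSeqs m,
      Matrix.single c ⟨e, he⟩ (1 : ℂ) ∈ (seminormal hq hq' m).range from
    (this d.1 (reflTransGen_of_shape_eq hc.2 hd.2 h fun k hk => by
      rw [hc.1 k hk, hd.1 k hk])).2
  intro e he
  induction he with
  | refl => exact ⟨c.2, single_self_mem_range hq hq' c⟩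
  | tail _ hstep ih =>
    rename_i b e _
    obtain ⟨hb, ih⟩ := ih
    obtain ⟨i, hi, hne, rfl⟩ := hstep
    have he := swapSeq_mem hi hb hne
    refine ⟨he, ?_⟩
    have hbi : b i ≠ b (i + 1) := ne_succ_of_mem hi ⟨b, hb⟩
    have hself : (⟨b, hb⟩ : contentSeqs m) ≠ ⟨swapSeq i b, he⟩ := fun h =>
      hbi ((congrFun (congrArg Subtype.val h) i).trans (swapSeq_left i b))
    have hcoeff : genMat q m i ⟨b, hb⟩ ⟨swapSeq i b, he⟩ = offCoeff q (b i) (b (i + 1)) := by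
      rw [genMat_apply, seqOp_apply, extZero_coe, Pi.single_eq_of_ne hself,
        extZero_coe _ (⟨swapSeq i b, he⟩ : contentSeqs m), Pi.single_eq_same]
      ring
    have hmem := mul_mem (mul_mem ih ⟨_, seminormal_tn hq hq' hi⟩)
      (single_self_mem_range hq hq' ⟨swapSeq i b, he⟩)
    rw [Matrix.single_mul_mul_single, hcoeff, one_mul, mul_one] at hmem
    have h0 := offCoeff_ne_zero hq hq' hbi hne
    have := Subalgebra.smul_mem _ hmem (offCoeff q (b i) (b (i + 1)))⁻¹
    rwa [Matrix.smul_single, smul_eq_mul, inv_mul_cancel₀ h0] at this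

lemma card_shape_pairs (m : ℕ) :
    Fintype.card {p : contentSeqs m × contentSeqs m // shape p.1.1 m = shape p.2.1 m} =
      m.factorial := by
  rw [← sum_numSeqs_shape, Fintype.card_subtype, Finset.card_filter, Fintype.sum_prod_type,
    ← Finset.sum_coe_sort (contentSeqs m)]
  refine Finset.sum_congr rfl fun c _ => ?_
  rw [numSeqs, ← Finset.sum_coe_sort (contentSeqs m)]
  refine Finset.sum_congr rfl fun d _ => ?_
  simp only [eq_comm]

lemma linearIndependent_single {ι : Type*} [Fintype ι] [DecidableEq ι] (p : ι × ι → Prop) :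
    LinearIndependent ℂ fun x : Subtype p => Matrix.single x.1.1 x.1.2 (1 : ℂ) := by
  have h := (Matrix.stdBasis ℂ ι ι).linearIndependent.comp (Subtype.val : Subtype p → _)
    Subtype.val_injective
  have he : ⇑(Matrix.stdBasis ℂ ι ι) ∘ (Subtype.val : Subtype p → _) =
      fun x => Matrix.single x.1.1 x.1.2 (1 : ℂ) :=
    funext fun x => Matrix.stdBasis_eq_single ℂ x.1.1 x.1.2
  rwa [he] at h

lemma seminormal_injective (hq : q ≠ 0) (hq' : NotRootOfUnity q) (hm : 1 ≤ m) :
    Function.Injective (seminormal hq hq' m) := by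
  have := finite_hecke hq hm
  set φ := (seminormal hq hq' m).toLinearMap with hφ
  have hli : LinearIndependent ℂ fun p : {p : contentSeqs m × contentSeqs m //
      shape p.1.1 m = shape p.2.1 m} => (⟨Matrix.single p.1.1 p.1.2 (1 : ℂ),
        single_mem_range hq hq' p.2⟩ : LinearMap.range φ) := by
    refine LinearIndependent.of_comp (LinearMap.range φ).subtype ?_
    exact linearIndependent_single fun p : contentSeqs m × contentSeqs m =>
      shape p.1.1 m = shape p.2.1 m
  have h1 := hli.fintype_card_le_finrank
  rw [card_shape_pairs] at h1
  have h2 := φ.finrank_range_add_finrank_ker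
  have h3 := finrank_hecke_le hq hm
  have h4 : LinearMap.ker φ = ⊥ := Submodule.finrank_eq_zero.1 (by omega)
  exact LinearMap.ker_eq_bot.1 h4

lemma existsUnique_idempotent (hq : q ≠ 0) (hq' : NotRootOfUnity q) (hm : 1 ≤ m) {c : ℕ → ℤ}
    (hc : c ∈ contentSeqs m) :
    ∃! e : Hecke q m, e ≠ 0 ∧ e * e = e ∧ ∀ k < m,
      yJM q m (k + 1) * e = (q ^ (2 * c k) : ℂ) • e ∧
      e * yJM q m (k + 1) = (q ^ (2 * c k) : ℂ) • e := by
  have hinj := seminormal_injective hq hq' hm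
  lift c to contentSeqs m using hc
  obtain ⟨e, he⟩ := single_self_mem_range hq hq' c
  change seminormal hq hq' m e = _ at he
  refine ⟨e, ⟨?_, hinj ?_, fun k hk => ⟨hinj ?_, hinj ?_⟩⟩, ?_⟩
  · rintro rfl
    have := congrFun (congrFun he c) c
    simp at this
  · rw [map_mul, he, Matrix.single_mul_single_same, one_mul]
  · rw [map_mul, map_smul, he, seminormal_yJM hq hq' hk]
    ext a b
    by_cases h : c = a <;> simp [Matrix.single_apply, jmOp, h]
  · rw [map_mul, map_smul, he, seminormal_yJM hq hq' hk]
    ext a b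
    by_cases h : c = b <;> simp [Matrix.single_apply, jmOp, h]
  · rintro f ⟨hf0, hff, hf⟩
    have hrow : ∀ a b, a ≠ c → seminormal hq hq' m f a b = 0 := by
      intro a b hac
      obtain ⟨k, hk, hne⟩ := exists_ne_of_ne hac
      have h := congrFun (congrFun (congrArg (seminormal hq hq' m) (hf k hk).1) a) b
      rw [map_mul, map_smul, seminormal_yJM hq hq' hk, Matrix.diagonal_mul, Matrix.smul_apply,
        smul_eq_mul, jmOp, ← sub_eq_zero, ← sub_mul] at h
      exact (mul_eq_zero.1 h).resolve_left (zpow_sub_ne_zero hq hq' hne)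
    have hcol : ∀ a b, b ≠ c → seminormal hq hq' m f a b = 0 := by
      intro a b hbc
      obtain ⟨k, hk, hne⟩ := exists_ne_of_ne hbc
      have h := congrFun (congrFun (congrArg (seminormal hq hq' m) (hf k hk).2) a) b
      rw [map_mul, map_smul, seminormal_yJM hq hq' hk, Matrix.mul_diagonal, Matrix.smul_apply,
        smul_eq_mul, jmOp, mul_comm, ← sub_eq_zero, ← sub_mul] at h
      exact (mul_eq_zero.1 h).resolve_left (zpow_sub_ne_zero hq hq' hne)
    have hform : seminormal hq hq' m f = Matrix.single c c (seminormal hq hq' m f c c) := by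
      ext a b
      by_cases ha : c = a
      · by_cases hb : c = b
        · subst ha; subst hb; simp
        · rw [hcol a b (Ne.symm hb), Matrix.single_apply_of_ne _ _ _ _ _ (fun h => hb h.2)]
      · rw [hrow a b (Ne.symm ha), Matrix.single_apply_of_ne _ _ _ _ _ (fun h => ha h.1)]
    have hsq := congrArg (seminormal hq hq' m) hff
    rw [map_mul, hform, Matrix.single_mul_single_same] at hsq
    have hsq := congrFun (congrFun hsq c) c
    rw [Matrix.single_apply_same, Matrix.single_apply_same] at hsq
    have hne : seminormal hq hq' m f c c ≠ 0 := by
      intro h0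
      rw [h0, Matrix.single_zero] at hform
      exact hf0 (hinj (hform.trans (map_zero _).symm))
    refine hinj ?_
    rw [he, hform, mul_right_cancel₀ hne (hsq.trans (one_mul _).symm)]

end

/-- for every standard `μ`-tableau `U` there is a unique nonzero idempotent
`e_U ∈ H_m` with `y_k e_U = e_U y_k = q^{2c_k(U)} e_U` for `k = 1, …, m`. -/
theorem primitive_idempotent_existsUnique (q : ℂ) (hq : q ≠ 0) (hq' : NotRootOfUnity q)
    (m : ℕ) (hm : 1 ≤ m) (μ : YoungDiagram) (hcard : μ.cells.card = m) (U : StdTab μ m) :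
    ∃! e : Hecke q m, IsJMIdem q m U e := by
  obtain ⟨e, ⟨he0, hee, he⟩, huniq⟩ := existsUnique_idempotent hq hq' hm (contentSeq_mem U)
  have hc : ∀ k, 1 ≤ k → k ≤ m → k - 1 < m ∧ k - 1 + 1 = k ∧ contentSeq U (k - 1) = ctnAt U k := by
    intro k h1 h2
    have hk : k - 1 + 1 = k := by omega
    exact ⟨by omega, hk, by rw [contentSeq, if_pos (by omega), hk]⟩
  refine ⟨e, ⟨he0, hee, fun k h1 h2 => ?_⟩, fun f ⟨hf0, hff, hf⟩ =>
    huniq f ⟨hf0, hff, fun k hk => ?_⟩⟩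
  · obtain ⟨h3, h4, h5⟩ := hc k h1 h2
    simpa only [h4, h5] using he (k - 1) h3
  · rw [contentSeq, if_pos hk]
    exact hf (k + 1) (by omega) (by omega)

end QImm
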